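/- Auxiliary Lemma and equivalence of PN¬ and PN: for every arrow term f : A ⊢ B of PN¬ one has f = i_B⁻¹ ∘ Ff ∘ i_A in PN¬, where F is the functor from PN¬ to PN and i_A : A ⊢ FA is the inductively defined isomorphism of PN¬; consequently i is a natural isomorphism from the identity functor on PN¬ to F¬F, and the categories PN¬ and PN are equivalent via the functors F : PN¬ → PN and F¬ : PN → PN¬. -/

import Mathlib

/-! ### The language L¬,∧,∨ generated from the set `P` of letters -/

inductive Form (P : Type) : Type
  | letter : P → Form P
  | neg : Form P → Form P
  | conj : Form P → Form P → Form P
  | disj : Form P → Form P → Form P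

infixr:70 " ⋏ " => Form.conj
infixr:66 " ⋎ " => Form.disj
prefix:77 "∼" => Form.neg

/-- The number of occurrences of letters in a formula (the object map of `G`). -/
def Form.size {P : Type} : Form P → ℕ
  | .letter _ => 1
  | .neg A => A.size
  | .conj A B => A.size + B.size
  | .disj A B => A.size + B.size
/-! ### Arrow terms of the free proof-net category PN¬ -/

inductive Term (P : Type) : Form P → Form P → Type
  | id (A : Form P) : Term P A A
  | comp {A B C : Form P} : Term P B C → Term P A B → Term P A C
  | conj {A B D E : Form P} : Term P A D → Term P B E → Term P (A ⋏ B) (D ⋏ E)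
  | disj {A B D E : Form P} : Term P A D → Term P B E → Term P (A ⋎ B) (D ⋎ E)
  | bConjTo (A B C : Form P) : Term P (A ⋏ (B ⋏ C)) ((A ⋏ B) ⋏ C)
  | bConjFrom (A B C : Form P) : Term P ((A ⋏ B) ⋏ C) (A ⋏ (B ⋏ C))
  | bDisjTo (A B C : Form P) : Term P (A ⋎ (B ⋎ C)) ((A ⋎ B) ⋎ C)
  | bDisjFrom (A B C : Form P) : Term P ((A ⋎ B) ⋎ C) (A ⋎ (B ⋎ C))
  | cConj (A B : Form P) : Term P (A ⋏ B) (B ⋏ A)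
  | cDisj (A B : Form P) : Term P (B ⋎ A) (A ⋎ B)
  | d (A B C : Form P) : Term P (A ⋏ (B ⋎ C)) ((A ⋏ B) ⋎ C)
  | delta (B A : Form P) : Term P A (A ⋏ (∼B ⋎ B))
  | sigma (B A : Form P) : Term P ((B ⋏ ∼B) ⋎ A) A

infixr:80 " ⬝ " => Term.comp
infixr:70 " ⊼ " => Term.conj
infixr:66 " ⊽ " => Term.disj

/-- The arrow `d^R_{C,B,A} : (C∨B)∧A ⊢ C∨(B∧A)`. -/
def dR {P : Type} (C B A : Form P) : Term P ((C ⋎ B) ⋏ A) (C ⋎ (B ⋏ A)) :=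
  Term.cDisj C (B ⋏ A) ⬝ ((Term.cConj A B ⊽ Term.id C) ⬝
    (Term.d A B C ⬝ ((Term.id A ⊼ Term.cDisj B C) ⬝ Term.cConj (C ⋎ B) A)))

/-- `Σ̂∧_{B,A} = ĉ∧ ∘ Δ̂∧_{B,A} : A ⊢ (¬B∨B)∧A`. -/
def sigmaConj {P : Type} (B A : Form P) : Term P A ((∼B ⋎ B) ⋏ A) :=
  Term.cConj A (∼B ⋎ B) ⬝ Term.delta B A

/-- `Δ̂∨_{B,A} = Σ̂∨_{B,A} ∘ ĉ∨ : A∨(B∧¬B) ⊢ A`. -/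
def deltaDisj {P : Type} (B A : Form P) : Term P (A ⋎ (B ⋏ ∼B)) A :=
  Term.sigma B A ⬝ Term.cDisj (B ⋏ ∼B) A

/-- `Δ̂∧′_{B,A} = (1_A ∧ ĉ∨) ∘ Δ̂∧_{B,A} : A ⊢ A∧(B∨¬B)`. -/
def delta' {P : Type} (B A : Form P) : Term P A (A ⋏ (B ⋎ ∼B)) :=
  (Term.id A ⊼ Term.cDisj B (∼B)) ⬝ Term.delta B A

/-- `Σ̂∨′_{B,A} = Σ̂∨_{B,A} ∘ (ĉ∧ ∨ 1_A) : (¬B∧B)∨A ⊢ A`. -/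
def sigma' {P : Type} (B A : Form P) : Term P ((∼B ⋏ B) ⋎ A) A :=
  Term.sigma B A ⬝ (Term.cConj (∼B) B ⊽ Term.id A)
/-! ### The equations of DS, imposed on arrow terms -/

inductive Eqv {P : Type} : ∀ {A B : Form P}, Term P A B → Term P A B → Prop
  -- equivalence and congruence
  | refl {A B : Form P} (f : Term P A B) : Eqv f f
  | symm {A B : Form P} {f g : Term P A B} : Eqv f g → Eqv g f
  | trans {A B : Form P} {f g h : Term P A B} : Eqv f g → Eqv g h → Eqv f h
  | congComp {A B C : Form P} {g g' : Term P B C} {f f' : Term P A B} :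
      Eqv g g' → Eqv f f' → Eqv (g ⬝ f) (g' ⬝ f')
  | congConj {A B D E : Form P} {f f' : Term P A D} {g g' : Term P B E} :
      Eqv f f' → Eqv g g' → Eqv (f ⊼ g) (f' ⊼ g')
  | congDisj {A B D E : Form P} {f f' : Term P A D} {g g' : Term P B E} :
      Eqv f f' → Eqv g g' → Eqv (f ⊽ g) (f' ⊽ g')
  -- (cat 1), (cat 2)
  | catIdR {A B : Form P} (f : Term P A B) : Eqv (f ⬝ Term.id A) f
  | catIdL {A B : Form P} (f : Term P A B) : Eqv (Term.id B ⬝ f) f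
  | catAssoc {A B C D : Form P} (f : Term P A B) (g : Term P B C) (h : Term P C D) :
      Eqv (h ⬝ (g ⬝ f)) ((h ⬝ g) ⬝ f)
  -- bifunctorial equations (ξ 1), (ξ 2)
  | conjOne (A B : Form P) : Eqv (Term.id A ⊼ Term.id B) (Term.id (A ⋏ B))
  | disjOne (A B : Form P) : Eqv (Term.id A ⊽ Term.id B) (Term.id (A ⋎ B))
  | conjTwo {A₁ B₁ C₁ A₂ B₂ C₂ : Form P} (g₁ : Term P B₁ C₁) (f₁ : Term P A₁ B₁)
      (g₂ : Term P B₂ C₂) (f₂ : Term P A₂ B₂) :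
      Eqv ((g₁ ⬝ f₁) ⊼ (g₂ ⬝ f₂)) ((g₁ ⊼ g₂) ⬝ (f₁ ⊼ f₂))
  | disjTwo {A₁ B₁ C₁ A₂ B₂ C₂ : Form P} (g₁ : Term P B₁ C₁) (f₁ : Term P A₁ B₁)
      (g₂ : Term P B₂ C₂) (f₂ : Term P A₂ B₂) :
      Eqv ((g₁ ⬝ f₁) ⊽ (g₂ ⬝ f₂)) ((g₁ ⊽ g₂) ⬝ (f₁ ⊽ f₂))
  -- naturality equations
  | bConjNat {A B C D E F : Form P} (f : Term P A D) (g : Term P B E) (h : Term P C F) :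
      Eqv (((f ⊼ g) ⊼ h) ⬝ Term.bConjTo A B C) (Term.bConjTo D E F ⬝ (f ⊼ (g ⊼ h)))
  | bDisjNat {A B C D E F : Form P} (f : Term P A D) (g : Term P B E) (h : Term P C F) :
      Eqv (((f ⊽ g) ⊽ h) ⬝ Term.bDisjTo A B C) (Term.bDisjTo D E F ⬝ (f ⊽ (g ⊽ h)))
  | cConjNat {A B D E : Form P} (f : Term P A D) (g : Term P B E) :
      Eqv ((g ⊼ f) ⬝ Term.cConj A B) (Term.cConj D E ⬝ (f ⊼ g))
  | cDisjNat {A B D E : Form P} (f : Term P A D) (g : Term P B E) :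
      Eqv ((g ⊽ f) ⬝ Term.cDisj B A) (Term.cDisj E D ⬝ (f ⊽ g))
  | dNat {A B C D E F : Form P} (f : Term P A D) (g : Term P B E) (h : Term P C F) :
      Eqv (((f ⊼ g) ⊽ h) ⬝ Term.d A B C) (Term.d D E F ⬝ (f ⊼ (g ⊽ h)))
  -- (b̂ξ b̂ξ)
  | bConjIso₁ (A B C : Form P) :
      Eqv (Term.bConjFrom A B C ⬝ Term.bConjTo A B C) (Term.id (A ⋏ (B ⋏ C)))
  | bConjIso₂ (A B C : Form P) :
      Eqv (Term.bConjTo A B C ⬝ Term.bConjFrom A B C) (Term.id ((A ⋏ B) ⋏ C))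
  | bDisjIso₁ (A B C : Form P) :
      Eqv (Term.bDisjFrom A B C ⬝ Term.bDisjTo A B C) (Term.id (A ⋎ (B ⋎ C)))
  | bDisjIso₂ (A B C : Form P) :
      Eqv (Term.bDisjTo A B C ⬝ Term.bDisjFrom A B C) (Term.id ((A ⋎ B) ⋎ C))
  -- (b̂ξ 5)
  | bConjPent (A B C D : Form P) :
      Eqv (Term.bConjFrom A B (C ⋏ D) ⬝ Term.bConjFrom (A ⋏ B) C D)
        ((Term.id A ⊼ Term.bConjFrom B C D) ⬝
          (Term.bConjFrom A (B ⋏ C) D ⬝ (Term.bConjFrom A B C ⊼ Term.id D)))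
  | bDisjPent (A B C D : Form P) :
      Eqv (Term.bDisjFrom A B (C ⋎ D) ⬝ Term.bDisjFrom (A ⋎ B) C D)
        ((Term.id A ⊽ Term.bDisjFrom B C D) ⬝
          (Term.bDisjFrom A (B ⋎ C) D ⬝ (Term.bDisjFrom A B C ⊽ Term.id D)))
  -- (ĉ∧ ĉ∧), (ĉ∨ ĉ∨)
  | cConjIso (A B : Form P) : Eqv (Term.cConj B A ⬝ Term.cConj A B) (Term.id (A ⋏ B))
  | cDisjIso (A B : Form P) : Eqv (Term.cDisj A B ⬝ Term.cDisj B A) (Term.id (A ⋎ B))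
  -- (b̂∧ ĉ∧), (b̂∨ ĉ∨)
  | bcConj (A B C : Form P) :
      Eqv ((Term.id B ⊼ Term.cConj C A) ⬝ (Term.bConjFrom B C A ⬝
            (Term.cConj A (B ⋏ C) ⬝ (Term.bConjFrom A B C ⬝ (Term.cConj B A ⊼ Term.id C)))))
        (Term.bConjFrom B A C)
  | bcDisj (A B C : Form P) :
      Eqv ((Term.id B ⊽ Term.cDisj A C) ⬝ (Term.bDisjFrom B C A ⬝
            (Term.cDisj (B ⋎ C) A ⬝ (Term.bDisjFrom A B C ⬝ (Term.cDisj A B ⊽ Term.id C)))))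
        (Term.bDisjFrom B A C)
  -- (d ∧), (d ∨)
  | dConj (A B C D : Form P) :
      Eqv ((Term.bConjFrom A B C ⊽ Term.id D) ⬝ Term.d (A ⋏ B) C D)
        (Term.d A (B ⋏ C) D ⬝ ((Term.id A ⊼ Term.d B C D) ⬝ Term.bConjFrom A B (C ⋎ D)))
  | dDisj (D C B A : Form P) :
      Eqv (Term.d D C (B ⋎ A) ⬝ (Term.id D ⊼ Term.bDisjFrom C B A))
        (Term.bDisjFrom (D ⋏ C) B A ⬝ ((Term.d D C B ⊽ Term.id A) ⬝ Term.d D (C ⋎ B) A))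
  -- (d b̂∧), (d b̂∨)
  | dBConj (A B C D : Form P) :
      Eqv (dR (A ⋏ B) C D ⬝ (Term.d A B C ⊼ Term.id D))
        (Term.d A B (C ⋏ D) ⬝ ((Term.id A ⊼ dR B C D) ⬝ Term.bConjFrom A (B ⋎ C) D))
  | dBDisj (D C B A : Form P) :
      Eqv ((Term.id D ⊽ Term.d C B A) ⬝ dR D C (B ⋎ A))
        (Term.bDisjFrom D (C ⋏ B) A ⬝ ((dR D C B ⊽ Term.id A) ⬝ Term.d (D ⋎ C) B A))
  -- (Δ̂∧ nat)
  | deltaNat {A D : Form P} (B : Form P) (f : Term P A D) :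
      Eqv ((f ⊼ Term.id (∼B ⋎ B)) ⬝ Term.delta B A) (Term.delta B D ⬝ f)
  -- (Σ̂∨ nat)
  | sigmaNat {A D : Form P} (B : Form P) (f : Term P A D) :
      Eqv (f ⬝ Term.sigma B A) (Term.sigma B D ⬝ (Term.id (B ⋏ ∼B) ⊽ f))
  -- (b̂∧ Δ̂∧)
  | bDelta (A B C : Form P) :
      Eqv (Term.bConjFrom A B (∼C ⋎ C) ⬝ Term.delta C (A ⋏ B)) (Term.id A ⊼ Term.delta C B)
  -- (b̂∨ Σ̂∨)
  | bSigma (C B A : Form P) :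
      Eqv (Term.sigma C (B ⋎ A) ⬝ Term.bDisjFrom (C ⋏ ∼C) B A) (Term.sigma C B ⊽ Term.id A)
  -- (d Σ̂∧)
  | dSigmaConj (A B C : Form P) :
      Eqv (Term.d (∼A ⋎ A) B C ⬝ sigmaConj A (B ⋎ C)) (sigmaConj A B ⊽ Term.id C)
  -- (d Δ̂∨)
  | dDeltaDisj (A C B : Form P) :
      Eqv (deltaDisj A (C ⋏ B) ⬝ Term.d C B (A ⋏ ∼A)) (Term.id C ⊼ deltaDisj A B)
  -- (Σ̂∨ Δ̂∧)
  | sigmaDelta (A : Form P) :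
      Eqv (Term.sigma A A ⬝ (Term.d A (∼A) A ⬝ Term.delta A A)) (Term.id A)
  -- (Σ̂∨′ Δ̂∧′)
  | sigmaDelta' (A : Form P) :
      Eqv (sigma' A (∼A) ⬝ (Term.d (∼A) A (∼A) ⬝ delta' A (∼A))) (Term.id (∼A))
/-! ### The category PN: the language L∧,∨^{¬p} and its arrow terms -/

inductive PForm (P : Type) : Type
  | pos : P → PForm P
  | natom : P → PForm P
  | conj : PForm P → PForm P → PForm P
  | disj : PForm P → PForm P → PForm P

infixr:70 " ⩕ " => PForm.conj
infixr:66 " ⩖ " => PForm.disj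

inductive PTerm (P : Type) : PForm P → PForm P → Type
  | id (A : PForm P) : PTerm P A A
  | comp {A B C : PForm P} : PTerm P B C → PTerm P A B → PTerm P A C
  | conj {A B D E : PForm P} : PTerm P A D → PTerm P B E → PTerm P (A ⩕ B) (D ⩕ E)
  | disj {A B D E : PForm P} : PTerm P A D → PTerm P B E → PTerm P (A ⩖ B) (D ⩖ E)
  | bConjTo (A B C : PForm P) : PTerm P (A ⩕ (B ⩕ C)) ((A ⩕ B) ⩕ C)
  | bConjFrom (A B C : PForm P) : PTerm P ((A ⩕ B) ⩕ C) (A ⩕ (B ⩕ C))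
  | bDisjTo (A B C : PForm P) : PTerm P (A ⩖ (B ⩖ C)) ((A ⩖ B) ⩖ C)
  | bDisjFrom (A B C : PForm P) : PTerm P ((A ⩖ B) ⩖ C) (A ⩖ (B ⩖ C))
  | cConj (A B : PForm P) : PTerm P (A ⩕ B) (B ⩕ A)
  | cDisj (A B : PForm P) : PTerm P (B ⩖ A) (A ⩖ B)
  | d (A B C : PForm P) : PTerm P (A ⩕ (B ⩖ C)) ((A ⩕ B) ⩖ C)
  | delta (p : P) (A : PForm P) : PTerm P A (A ⩕ (PForm.natom p ⩖ PForm.pos p))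
  | sigma (p : P) (A : PForm P) : PTerm P ((PForm.pos p ⩕ PForm.natom p) ⩖ A) A

infixr:80 " ⊚ " => PTerm.comp
infixr:70 " ⊛ " => PTerm.conj
infixr:66 " ⊘ " => PTerm.disj

/-- The arrow `d^R_{C,B,A} : (C∨B)∧A ⊢ C∨(B∧A)` of PN. -/
def pdR {P : Type} (C B A : PForm P) : PTerm P ((C ⩖ B) ⩕ A) (C ⩖ (B ⩕ A)) :=
  PTerm.cDisj C (B ⩕ A) ⊚ ((PTerm.cConj A B ⊘ PTerm.id C) ⊚
    (PTerm.d A B C ⊚ ((PTerm.id A ⊛ PTerm.cDisj B C) ⊚ PTerm.cConj (C ⩖ B) A)))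
/-! ### The functor F from PN¬ to PN -/

/-- `F` on objects, together with the `F`-image of the negation of the formula:
`Fboth A = (FA, F¬A)`. -/
def Fboth {P : Type} : Form P → PForm P × PForm P
  | .letter p => (.pos p, .natom p)
  | .neg B => ((Fboth B).2, (Fboth B).1)
  | .conj A B => ((Fboth A).1 ⩕ (Fboth B).1, (Fboth A).2 ⩖ (Fboth B).2)
  | .disj A B => ((Fboth A).1 ⩖ (Fboth B).1, (Fboth A).2 ⩕ (Fboth B).2)

/-- `F` on objects. -/
def Fpos {P : Type} (A : Form P) : PForm P := (Fboth A).1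

/-- `F¬A = F(¬A)`. -/
def Fneg {P : Type} (A : Form P) : PForm P := (Fboth A).2

/-- `FΔ̂∧_{B,A} : FA ⊢ FA ∧ (F¬B ∨ FB)`, defined by recursion on the crown index `B`. -/
def Fdelta {P : Type} : (B A : Form P) → PTerm P (Fpos A) (Fpos A ⩕ (Fneg B ⩖ Fpos B))
  | .letter p, A => PTerm.delta p (Fpos A)
  | .neg C, A => (PTerm.id (Fpos A) ⊛ PTerm.cDisj (Fpos C) (Fneg C)) ⊚ Fdelta C A
  | .conj C D, A =>
      (PTerm.id (Fpos A) ⊛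
        ((PTerm.cDisj (Fneg C) (Fneg D) ⊘ PTerm.id (Fpos C ⩕ Fpos D)) ⊚
          (PTerm.bDisjTo (Fneg D) (Fneg C) (Fpos C ⩕ Fpos D) ⊚
            (PTerm.id (Fneg D) ⊘
              (pdR (Fneg C) (Fpos C) (Fpos D) ⊚
                (PTerm.cConj (Fpos D) (Fneg C ⩖ Fpos C) ⊚ Fdelta C D)))))) ⊚
        Fdelta D A
  | .disj C D, A =>
      (PTerm.id (Fpos A) ⊛
        ((PTerm.cConj (Fneg D) (Fneg C) ⊘ PTerm.id (Fpos C ⩖ Fpos D)) ⊚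
          (PTerm.bDisjFrom (Fneg D ⩕ Fneg C) (Fpos C) (Fpos D) ⊚
            ((PTerm.d (Fneg D) (Fneg C) (Fpos C) ⊚ Fdelta C (Form.neg D)) ⊘
              PTerm.id (Fpos D))))) ⊚
        Fdelta D A

/-- `FΣ̂∨_{B,A} : (FB ∧ F¬B) ∨ FA ⊢ FA`, defined by recursion on the crown index `B`. -/
def Fsigma {P : Type} : (B A : Form P) → PTerm P ((Fpos B ⩕ Fneg B) ⩖ Fpos A) (Fpos A)
  | .letter p, A => PTerm.sigma p (Fpos A)
  | .neg C, A => Fsigma C A ⊚ (PTerm.cConj (Fneg C) (Fpos C) ⊘ PTerm.id (Fpos A))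
  | .conj C D, A =>
      Fsigma D A ⊚
        (((PTerm.id (Fpos D) ⊛
            (Fsigma C (Form.neg D) ⊚ PTerm.d (Fpos C) (Fneg C) (Fneg D))) ⊚
          (PTerm.bConjFrom (Fpos D) (Fpos C) (Fneg C ⩖ Fneg D) ⊚
            (PTerm.cConj (Fpos C) (Fpos D) ⊛ PTerm.id (Fneg C ⩖ Fneg D)))) ⊘
          PTerm.id (Fpos A))
  | .disj C D, A =>
      Fsigma D A ⊚
        ((((Fsigma C D ⊚
              (PTerm.cDisj (Fpos C ⩕ Fneg C) (Fpos D) ⊚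
                pdR (Fpos D) (Fpos C) (Fneg C))) ⊛ PTerm.id (Fneg D)) ⊚
          (PTerm.bConjTo (Fpos D ⩖ Fpos C) (Fneg C) (Fneg D) ⊚
            (PTerm.cDisj (Fpos D) (Fpos C) ⊛ PTerm.id (Fneg C ⩕ Fneg D)))) ⊘
          PTerm.id (Fpos A))

/-- The functor `F` from PN¬ to PN on arrow terms. -/
def Ft {P : Type} : ∀ {A B : Form P}, Term P A B → PTerm P (Fpos A) (Fpos B)
  | _, _, .id A => PTerm.id (Fpos A)
  | _, _, .comp g f => Ft g ⊚ Ft f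
  | _, _, .conj f g => Ft f ⊛ Ft g
  | _, _, .disj f g => Ft f ⊘ Ft g
  | _, _, .bConjTo A B C => PTerm.bConjTo (Fpos A) (Fpos B) (Fpos C)
  | _, _, .bConjFrom A B C => PTerm.bConjFrom (Fpos A) (Fpos B) (Fpos C)
  | _, _, .bDisjTo A B C => PTerm.bDisjTo (Fpos A) (Fpos B) (Fpos C)
  | _, _, .bDisjFrom A B C => PTerm.bDisjFrom (Fpos A) (Fpos B) (Fpos C)
  | _, _, .cConj A B => PTerm.cConj (Fpos A) (Fpos B)
  | _, _, .cDisj A B => PTerm.cDisj (Fpos A) (Fpos B)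
  | _, _, .d A B C => PTerm.d (Fpos A) (Fpos B) (Fpos C)
  | _, _, .delta B A => Fdelta B A
  | _, _, .sigma B A => Fsigma B A

/-! ### The functor F¬ from PN to PN¬ (the inclusion) -/

/-- The objects of PN, viewed as formulae of L¬,∧,∨. -/
def emb {P : Type} : PForm P → Form P
  | .pos p => .letter p
  | .natom p => ∼(Form.letter p)
  | .conj A B => emb A ⋏ emb B
  | .disj A B => emb A ⋎ emb B

/-- The functor `F¬` from PN to PN¬ on arrow terms (the inclusion). -/
def embT {P : Type} : ∀ {A B : PForm P}, PTerm P A B → Term P (emb A) (emb B)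
  | _, _, .id A => Term.id (emb A)
  | _, _, .comp g f => embT g ⬝ embT f
  | _, _, .conj f g => embT f ⊼ embT g
  | _, _, .disj f g => embT f ⊽ embT g
  | _, _, .bConjTo A B C => Term.bConjTo (emb A) (emb B) (emb C)
  | _, _, .bConjFrom A B C => Term.bConjFrom (emb A) (emb B) (emb C)
  | _, _, .bDisjTo A B C => Term.bDisjTo (emb A) (emb B) (emb C)
  | _, _, .bDisjFrom A B C => Term.bDisjFrom (emb A) (emb B) (emb C)
  | _, _, .cConj A B => Term.cConj (emb A) (emb B)
  | _, _, .cDisj A B => Term.cDisj (emb A) (emb B)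
  | _, _, .d A B C => Term.d (emb A) (emb B) (emb C)
  | _, _, .delta p A => Term.delta (Form.letter p) (emb A)
  | _, _, .sigma p A => Term.sigma (Form.letter p) (emb A)

/-! ### The isomorphisms n, r̂ and i of PN¬ -/

/-- `Σ̂∧′_{B,A} = ĉ∧ ∘ Δ̂∧′_{B,A} : A ⊢ (B∨¬B)∧A`. -/
def sigmaConj' {P : Type} (B A : Form P) : Term P A ((B ⋎ ∼B) ⋏ A) :=
  Term.cConj A (B ⋎ ∼B) ⬝ delta' B A

/-- `Δ̂∨′_{B,A} = Σ̂∨′_{B,A} ∘ ĉ∨ : A∨(¬B∧B) ⊢ A`. -/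
def deltaDisj' {P : Type} (B A : Form P) : Term P (A ⋎ (∼B ⋏ B)) A :=
  sigma' B A ⬝ Term.cDisj (∼B ⋏ B) A

/-- `n→_A : ¬¬A ⊢ A`. -/
def nTo {P : Type} (A : Form P) : Term P (∼∼A) A :=
  sigma' (∼A) A ⬝ (Term.d (∼∼A) (∼A) A ⬝ Term.delta A (∼∼A))

/-- `n←_A : A ⊢ ¬¬A`. -/
def nFrom {P : Type} (A : Form P) : Term P A (∼∼A) :=
  Term.sigma A (∼∼A) ⬝ (Term.d A (∼A) (∼∼A) ⬝ delta' (∼A) A)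

/-- `r̂∧→_{A,B} : ¬(A∧B) ⊢ ¬A∨¬B`. -/
def rConjTo {P : Type} (A B : Form P) : Term P (∼(A ⋏ B)) (∼A ⋎ ∼B) :=
  sigma' (A ⋏ B) (∼A ⋎ ∼B) ⬝
    (Term.d (∼(A ⋏ B)) (A ⋏ B) (∼A ⋎ ∼B) ⬝
      ((Term.id (∼(A ⋏ B)) ⊼
          ((Term.id (A ⋏ B) ⊽ Term.cDisj (∼A) (∼B)) ⬝
            (Term.bDisjFrom (A ⋏ B) (∼B) (∼A) ⬝
              ((Term.d A B (∼B) ⬝ delta' B A) ⊽ Term.id (∼A))))) ⬝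
        delta' A (∼(A ⋏ B))))

/-- `r̂∧←_{A,B} : ¬A∨¬B ⊢ ¬(A∧B)`. -/
def rConjFrom {P : Type} (A B : Form P) : Term P (∼A ⋎ ∼B) (∼(A ⋏ B)) :=
  sigma' A (∼(A ⋏ B)) ⬝
    (((((deltaDisj' B (∼A) ⬝ dR (∼A) (∼B) B) ⊼ Term.id A) ⬝
        (Term.bConjTo (∼A ⋎ ∼B) B A ⬝
          (Term.id (∼A ⋎ ∼B) ⊼ Term.cConj A B))) ⊽ Term.id (∼(A ⋏ B))) ⬝
      (Term.d (∼A ⋎ ∼B) (A ⋏ B) (∼(A ⋏ B)) ⬝ delta' (A ⋏ B) (∼A ⋎ ∼B)))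

/-- `r̂∨→_{A,B} : ¬(A∨B) ⊢ ¬A∧¬B`. -/
def rDisjTo {P : Type} (A B : Form P) : Term P (∼(A ⋎ B)) (∼A ⋏ ∼B) :=
  sigma' (A ⋎ B) (∼A ⋏ ∼B) ⬝
    (Term.d (∼(A ⋎ B)) (A ⋎ B) (∼A ⋏ ∼B) ⬝
      ((Term.id (∼(A ⋎ B)) ⊼
          ((Term.cDisj A B ⊽ Term.id (∼A ⋏ ∼B)) ⬝
            (Term.bDisjTo B A (∼A ⋏ ∼B) ⬝
              (Term.id B ⊽ (dR A (∼A) (∼B) ⬝ sigmaConj' A (∼B)))))) ⬝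
        delta' B (∼(A ⋎ B))))

/-- `r̂∨←_{A,B} : ¬A∧¬B ⊢ ¬(A∨B)`. -/
def rDisjFrom {P : Type} (A B : Form P) : Term P (∼A ⋏ ∼B) (∼(A ⋎ B)) :=
  sigma' B (∼(A ⋎ B)) ⬝
    ((((Term.id (∼B) ⊼ (sigma' A B ⬝ Term.d (∼A) A B)) ⬝
        (Term.bConjFrom (∼B) (∼A) (A ⋎ B) ⬝
          (Term.cConj (∼A) (∼B) ⊼ Term.id (A ⋎ B)))) ⊽ Term.id (∼(A ⋎ B))) ⬝
      (Term.d (∼A ⋏ ∼B) (A ⋎ B) (∼(A ⋎ B)) ⬝ delta' (A ⋎ B) (∼A ⋏ ∼B)))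

mutual
/-- The isomorphism `i_A : A ⊢ FA` of PN¬, defined by induction on `A`. -/
def iPos {P : Type} : (A : Form P) → Term P A (emb (Fpos A))
  | .letter _ => Term.id _
  | .neg B => iNeg B
  | .conj A B => iPos A ⊼ iPos B
  | .disj A B => iPos A ⊽ iPos B

/-- The component `i_{¬B} : ¬B ⊢ F¬B` of the isomorphism `i`. -/
def iNeg {P : Type} : (B : Form P) → Term P (∼B) (emb (Fneg B))
  | .letter _ => Term.id _
  | .neg C => iPos C ⬝ nTo C
  | .conj C D => (iNeg C ⊽ iNeg D) ⬝ rConjTo C D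
  | .disj C D => (iNeg C ⊼ iNeg D) ⬝ rDisjTo C D
end

mutual
/-- The inverse isomorphism `i_A⁻¹ : FA ⊢ A` of PN¬. -/
def iPosInv {P : Type} : (A : Form P) → Term P (emb (Fpos A)) A
  | .letter _ => Term.id _
  | .neg B => iNegInv B
  | .conj A B => iPosInv A ⊼ iPosInv B
  | .disj A B => iPosInv A ⊽ iPosInv B

/-- The component `i_{¬B}⁻¹ : F¬B ⊢ ¬B` of the inverse isomorphism. -/
def iNegInv {P : Type} : (B : Form P) → Term P (emb (Fneg B)) (∼B)
  | .letter _ => Term.id _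
  | .neg C => nFrom C ⬝ iPosInv C
  | .conj C D => rConjFrom C D ⬝ (iNegInv C ⊽ iNegInv D)
  | .disj C D => rDisjFrom C D ⬝ (iNegInv C ⊼ iNegInv D)
end


namespace PNProof

open CategoryTheory

/-- Symmetric linearly distributive categories without units. -/
class LD (O : Type) extends Category.{0} O where
  T : O → O → O
  S : O → O → O
  tm : ∀ {A B D E : O}, (A ⟶ D) → (B ⟶ E) → (T A B ⟶ T D E)
  sm : ∀ {A B D E : O}, (A ⟶ D) → (B ⟶ E) → (S A B ⟶ S D E)
  tm_id : ∀ A B : O, tm (𝟙 A) (𝟙 B) = 𝟙 (T A B)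
  sm_id : ∀ A B : O, sm (𝟙 A) (𝟙 B) = 𝟙 (S A B)
  tm_comp : ∀ {A B D A' B' D' : O} (f : A ⟶ B) (g : B ⟶ D) (f' : A' ⟶ B') (g' : B' ⟶ D'),
    tm f f' ≫ tm g g' = tm (f ≫ g) (f' ≫ g')
  sm_comp : ∀ {A B D A' B' D' : O} (f : A ⟶ B) (g : B ⟶ D) (f' : A' ⟶ B') (g' : B' ⟶ D'),
    sm f f' ≫ sm g g' = sm (f ≫ g) (f' ≫ g')
  aT : ∀ A B D : O, T A (T B D) ⟶ T (T A B) D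
  aT' : ∀ A B D : O, T (T A B) D ⟶ T A (T B D)
  aS : ∀ A B D : O, S A (S B D) ⟶ S (S A B) D
  aS' : ∀ A B D : O, S (S A B) D ⟶ S A (S B D)
  aT_aT' : ∀ A B D : O, aT A B D ≫ aT' A B D = 𝟙 _
  aT'_aT : ∀ A B D : O, aT' A B D ≫ aT A B D = 𝟙 _
  aS_aS' : ∀ A B D : O, aS A B D ≫ aS' A B D = 𝟙 _
  aS'_aS : ∀ A B D : O, aS' A B D ≫ aS A B D = 𝟙 _
  aT_nat : ∀ {A B D A' B' D' : O} (f : A ⟶ A') (g : B ⟶ B') (h : D ⟶ D'),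
    tm f (tm g h) ≫ aT A' B' D' = aT A B D ≫ tm (tm f g) h
  aS_nat : ∀ {A B D A' B' D' : O} (f : A ⟶ A') (g : B ⟶ B') (h : D ⟶ D'),
    sm f (sm g h) ≫ aS A' B' D' = aS A B D ≫ sm (sm f g) h
  cT : ∀ A B : O, T A B ⟶ T B A
  cS : ∀ A B : O, S A B ⟶ S B A
  cT_cT : ∀ A B : O, cT A B ≫ cT B A = 𝟙 _
  cS_cS : ∀ A B : O, cS A B ≫ cS B A = 𝟙 _
  cT_nat : ∀ {A B A' B' : O} (f : A ⟶ A') (g : B ⟶ B'),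
    tm f g ≫ cT A' B' = cT A B ≫ tm g f
  cS_nat : ∀ {A B A' B' : O} (f : A ⟶ A') (g : B ⟶ B'),
    sm f g ≫ cS A' B' = cS A B ≫ sm g f
  hexT : ∀ A B D : O, aT' A B D ≫ cT A (T B D) ≫ aT' B D A =
    tm (cT A B) (𝟙 D) ≫ aT' B A D ≫ tm (𝟙 B) (cT A D)
  hexS : ∀ A B D : O, aS' A B D ≫ cS A (S B D) ≫ aS' B D A =
    sm (cS A B) (𝟙 D) ≫ aS' B A D ≫ sm (𝟙 B) (cS A D)
  d : ∀ A B D : O, T A (S B D) ⟶ S (T A B) D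
  ddR : ∀ A B D : O, T (S A B) D ⟶ S A (T B D)
  dR_eq : ∀ A B D : O, ddR A B D =
    cT (S A B) D ≫ tm (𝟙 D) (cS A B) ≫ d D B A ≫ sm (cT D B) (𝟙 A) ≫ cS (T B D) A
  d_nat : ∀ {A B D A' B' D' : O} (f : A ⟶ A') (g : B ⟶ B') (h : D ⟶ D'),
    tm f (sm g h) ≫ d A' B' D' = d A B D ≫ sm (tm f g) h
  d_conj : ∀ A B D E : O, d (T A B) D E ≫ sm (aT' A B D) (𝟙 E) =
    aT' A B (S D E) ≫ tm (𝟙 A) (d B D E) ≫ d A (T B D) E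
  d_disj : ∀ A B D E : O, tm (𝟙 A) (aS' B D E) ≫ d A B (S D E) =
    d A (S B D) E ≫ sm (d A B D) (𝟙 E) ≫ aS' (T A B) D E
  d_bconj : ∀ A B D E : O, tm (d A B D) (𝟙 E) ≫ ddR (T A B) D E =
    aT' A (S B D) E ≫ tm (𝟙 A) (ddR B D E) ≫ d A B (T D E)
  d_bdisj : ∀ A B D E : O, ddR A B (S D E) ≫ sm (𝟙 A) (d B D E) =
    d (S A B) D E ≫ sm (ddR A B D) (𝟙 E) ≫ aS' A (T B D) E

open LD

attribute [simp] tm_comp sm_comp tm_id sm_id aT_aT' aT'_aT aS_aS' aS'_aS cT_cT cS_cS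

section basics
variable {O : Type} [LD O]

@[simp] theorem tm_comp_a {A B D A' B' D' Z : O} (f : A ⟶ B) (g : B ⟶ D) (f' : A' ⟶ B')
    (g' : B' ⟶ D') (k : T D D' ⟶ Z) : tm f f' ≫ tm g g' ≫ k = tm (f ≫ g) (f' ≫ g') ≫ k := by
  rw [← Category.assoc, tm_comp]
@[simp] theorem sm_comp_a {A B D A' B' D' Z : O} (f : A ⟶ B) (g : B ⟶ D) (f' : A' ⟶ B')
    (g' : B' ⟶ D') (k : S D D' ⟶ Z) : sm f f' ≫ sm g g' ≫ k = sm (f ≫ g) (f' ≫ g') ≫ k := by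
  rw [← Category.assoc, sm_comp]
@[simp] theorem aT_aT'_a {A B D Z : O} (k : T A (T B D) ⟶ Z) :
    aT A B D ≫ aT' A B D ≫ k = k := by rw [← Category.assoc, aT_aT', Category.id_comp]
@[simp] theorem aT'_aT_a {A B D Z : O} (k : T (T A B) D ⟶ Z) :
    aT' A B D ≫ aT A B D ≫ k = k := by rw [← Category.assoc, aT'_aT, Category.id_comp]
@[simp] theorem aS_aS'_a {A B D Z : O} (k : S A (S B D) ⟶ Z) :
    aS A B D ≫ aS' A B D ≫ k = k := by rw [← Category.assoc, aS_aS', Category.id_comp]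
@[simp] theorem aS'_aS_a {A B D Z : O} (k : S (S A B) D ⟶ Z) :
    aS' A B D ≫ aS A B D ≫ k = k := by rw [← Category.assoc, aS'_aS, Category.id_comp]
@[simp] theorem cT_cT_a {A B Z : O} (k : T A B ⟶ Z) :
    cT A B ≫ cT B A ≫ k = k := by rw [← Category.assoc, cT_cT, Category.id_comp]
@[simp] theorem cS_cS_a {A B Z : O} (k : S A B ⟶ Z) :
    cS A B ≫ cS B A ≫ k = k := by rw [← Category.assoc, cS_cS, Category.id_comp]
theorem cT_nat_a {A B A' B' Z : O} (f : A ⟶ A') (g : B ⟶ B') (k : T B' A' ⟶ Z) :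
    tm f g ≫ cT A' B' ≫ k = cT A B ≫ tm g f ≫ k := by
  rw [← Category.assoc, cT_nat, Category.assoc]
theorem cS_nat_a {A B A' B' Z : O} (f : A ⟶ A') (g : B ⟶ B') (k : S B' A' ⟶ Z) :
    sm f g ≫ cS A' B' ≫ k = cS A B ≫ sm g f ≫ k := by
  rw [← Category.assoc, cS_nat, Category.assoc]
theorem d_nat_a {A B D A' B' D' Z : O} (f : A ⟶ A') (g : B ⟶ B') (h : D ⟶ D')
    (k : S (T A' B') D' ⟶ Z) :
    tm f (sm g h) ≫ d A' B' D' ≫ k = d A B D ≫ sm (tm f g) h ≫ k := by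
  rw [← Category.assoc, d_nat, Category.assoc]
theorem aT_nat_a {A B D A' B' D' Z : O} (f : A ⟶ A') (g : B ⟶ B') (h : D ⟶ D')
    (k : T (T A' B') D' ⟶ Z) :
    tm f (tm g h) ≫ aT A' B' D' ≫ k = aT A B D ≫ tm (tm f g) h ≫ k := by
  rw [← Category.assoc, aT_nat, Category.assoc]
theorem aS_nat_a {A B D A' B' D' Z : O} (f : A ⟶ A') (g : B ⟶ B') (h : D ⟶ D')
    (k : S (S A' B') D' ⟶ Z) :
    sm f (sm g h) ≫ aS A' B' D' ≫ k = aS A B D ≫ sm (sm f g) h ≫ k := by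
  rw [← Category.assoc, aS_nat, Category.assoc]
theorem aT'_nat {A B D A' B' D' : O} (f : A ⟶ A') (g : B ⟶ B') (h : D ⟶ D') :
    tm (tm f g) h ≫ aT' A' B' D' = aT' A B D ≫ tm f (tm g h) := by
  have := congrArg (fun k => aT' A B D ≫ k ≫ aT' A' B' D') (aT_nat f g h)
  simpa using this.symm
theorem aS'_nat {A B D A' B' D' : O} (f : A ⟶ A') (g : B ⟶ B') (h : D ⟶ D') :
    sm (sm f g) h ≫ aS' A' B' D' = aS' A B D ≫ sm f (sm g h) := by
  have := congrArg (fun k => aS' A B D ≫ k ≫ aS' A' B' D') (aS_nat f g h)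
  simpa using this.symm
theorem aT'_nat_a {A B D A' B' D' Z : O} (f : A ⟶ A') (g : B ⟶ B') (h : D ⟶ D')
    (k : T A' (T B' D') ⟶ Z) :
    tm (tm f g) h ≫ aT' A' B' D' ≫ k = aT' A B D ≫ tm f (tm g h) ≫ k := by
  rw [← Category.assoc, aT'_nat, Category.assoc]
theorem aS'_nat_a {A B D A' B' D' Z : O} (f : A ⟶ A') (g : B ⟶ B') (h : D ⟶ D')
    (k : S A' (S B' D') ⟶ Z) :
    sm (sm f g) h ≫ aS' A' B' D' ≫ k = aS' A B D ≫ sm f (sm g h) ≫ k := by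
  rw [← Category.assoc, aS'_nat, Category.assoc]
theorem dR_nat {A B D A' B' D' : O} (f : A ⟶ A') (g : B ⟶ B') (h : D ⟶ D') :
    tm (sm f g) h ≫ ddR A' B' D' = ddR A B D ≫ sm f (tm g h) := by
  have h1 : tm h (sm f g) ≫ tm (𝟙 _) (cS A' B') = tm (𝟙 _) (cS A B) ≫ tm h (sm g f) := by
    rw [tm_comp, cS_nat]; simp [tm_comp]
  have h2 : sm (tm h g) f ≫ sm (cT _ _) (𝟙 _) = sm (cT _ _) (𝟙 _) ≫ sm (tm g h) f := by
    rw [sm_comp, cT_nat]; simp [sm_comp]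
  simp only [dR_eq, Category.assoc]
  rw [cT_nat_a, reassoc_of% h1, d_nat_a, reassoc_of% h2, cS_nat]
theorem dR_nat_a {A B D A' B' D' Z : O} (f : A ⟶ A') (g : B ⟶ B') (h : D ⟶ D')
    (k : S A' (T B' D') ⟶ Z) :
    tm (sm f g) h ≫ ddR A' B' D' ≫ k = ddR A B D ≫ sm f (tm g h) ≫ k := by
  rw [← Category.assoc, dR_nat, Category.assoc]

theorem tmL {A B D E : O} (f : A ⟶ B) (g : B ⟶ D) :
    tm (f ≫ g) (𝟙 E) = tm f (𝟙 E) ≫ tm g (𝟙 E) := by simp [tm_comp]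
theorem tmR {A B D E : O} (f : A ⟶ B) (g : B ⟶ D) :
    tm (𝟙 E) (f ≫ g) = tm (𝟙 E) f ≫ tm (𝟙 E) g := by simp [tm_comp]
theorem smL {A B D E : O} (f : A ⟶ B) (g : B ⟶ D) :
    sm (f ≫ g) (𝟙 E) = sm f (𝟙 E) ≫ sm g (𝟙 E) := by simp [sm_comp]
theorem smR {A B D E : O} (f : A ⟶ B) (g : B ⟶ D) :
    sm (𝟙 E) (f ≫ g) = sm (𝟙 E) f ≫ sm (𝟙 E) g := by simp [sm_comp]

theorem revS (A B D : O) : cS A (S B D) ≫ sm (cS B D) (𝟙 A) ≫ aS' D B A =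
    aS A B D ≫ cS (S A B) D ≫ sm (𝟙 D) (cS A B) := by
  have h1 : cS A (S B D) ≫ aS' B D A = aS A B D ≫ sm (cS A B) (𝟙 D) ≫ aS' B A D ≫
      sm (𝟙 B) (cS A D) := by
    rw [← hexS, aS_aS'_a]
  have h2 : aS' D B A = sm (cS D B) (𝟙 A) ≫ aS' B D A ≫ sm (𝟙 B) (cS D A) ≫
      aS B A D ≫ cS (S B A) D := by
    have := hexS D B A
    have := congrArg (fun k => k ≫ aS B A D ≫ cS (S B A) D) this
    simpa using this
  rw [h2]
  simp only [sm_comp_a, cS_cS, Category.comp_id, sm_id, Category.id_comp]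
  rw [reassoc_of% h1]
  simp [cS_nat]

theorem revT (A B D : O) : cT A (T B D) ≫ tm (cT B D) (𝟙 A) ≫ aT' D B A =
    aT A B D ≫ cT (T A B) D ≫ tm (𝟙 D) (cT A B) := by
  have h1 : cT A (T B D) ≫ aT' B D A = aT A B D ≫ tm (cT A B) (𝟙 D) ≫ aT' B A D ≫
      tm (𝟙 B) (cT A D) := by
    rw [← hexT, aT_aT'_a]
  have h2 : aT' D B A = tm (cT D B) (𝟙 A) ≫ aT' B D A ≫ tm (𝟙 B) (cT D A) ≫
      aT B A D ≫ cT (T B A) D := by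
    have := hexT D B A
    have := congrArg (fun k => k ≫ aT B A D ≫ cT (T B A) D) this
    simpa using this
  rw [h2]
  simp only [tm_comp_a, cT_cT, Category.comp_id, tm_id, Category.id_comp]
  rw [reassoc_of% h1]
  simp [cT_nat]

theorem d_eq (A B D : O) : d A B D =
    cT A (S B D) ≫ tm (cS B D) (𝟙 A) ≫ ddR D B A ≫ sm (𝟙 D) (cT B A) ≫ cS D (T A B) := by
  rw [dR_eq]
  simp only [Category.assoc]
  rw [cT_nat_a, cT_cT_a, tm_comp_a, ← cS_nat_a]
  simp

theorem cT_dR (A B D : O) : cT D (S A B) ≫ ddR A B D =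
    tm (𝟙 D) (cS A B) ≫ d D B A ≫ sm (cT D B) (𝟙 A) ≫ cS (T B D) A := by
  rw [dR_eq, cT_cT_a]

theorem dR_disj (A B D E : O) : tm (aS A B D) (𝟙 E) ≫ ddR (S A B) D E =
    ddR A (S B D) E ≫ sm (𝟙 A) (ddR B D E) ≫ aS A B (T D E) := by
  have h1 : aS A B D ≫ cS (S A B) D = cS A (S B D) ≫ sm (cS B D) (𝟙 A) ≫ aS' D B A ≫
      sm (𝟙 D) (cS B A) := by
    have := congrArg (fun k => k ≫ sm (𝟙 D) (cS B A)) (revS A B D)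
    simpa using this.symm
  have h2 : ∀ Q : O, aS' Q B A ≫ sm (𝟙 Q) (cS B A) ≫ cS Q (S A B) =
      sm (cS Q B) (𝟙 A) ≫ cS (S B Q) A ≫ aS A B Q := by
    intro Q
    have := congrArg (fun k => sm (cS Q B) (𝟙 A) ≫ cS (S B Q) A ≫ k ≫ sm (𝟙 Q) (cS B A) ≫
      cS Q (S A B)) (revS A B Q)
    simpa using this
  have h3 : sm (ddR B D E) (𝟙 A) = sm (cT _ _ ≫ tm (𝟙 _) (cS _ _) ≫ d E D B ≫
      sm (cT _ _) (𝟙 _) ≫ cS _ _) (𝟙 A) := by rw [dR_eq]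
  rw [dR_eq (S A B), dR_eq A, cT_nat_a]
  simp only [Category.assoc]
  rw [← cS_nat_a, h3]
  simp only [smL, Category.assoc]
  rw [← h2, tm_comp_a, h1]
  have h4 := d_disj E D B A
  have h5 : tm (𝟙 E) (sm (𝟙 D) (cS B A)) ≫ d E D (S A B) =
    d E D (S B A) ≫ sm (𝟙 _) (cS B A) := by rw [d_nat]; simp
  have h6 : tm (𝟙 E) (sm (cS B D) (𝟙 A)) ≫ d E (S D B) A =
    d E (S B D) A ≫ sm (tm (𝟙 _) (cS B D)) (𝟙 A) := by rw [d_nat]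
  simp only [Category.id_comp, tmR, Category.assoc]
  rw [reassoc_of% h5, reassoc_of% h4, reassoc_of% h6]
  have h7 : sm (𝟙 (T E D)) (cS B A) ≫ sm (cT E D) (𝟙 (S A B)) =
    sm (cT E D) (𝟙 _) ≫ sm (𝟙 _) (cS B A) := by simp
  have h8 : sm (sm (cT E D) (𝟙 B)) (𝟙 A) ≫ aS' _ _ _ = aS' _ _ _ ≫ sm (cT E D) (𝟙 _) := by
    rw [aS'_nat]; simp
  rw [reassoc_of% h7, ← reassoc_of% h8]
  simp

theorem dR_conj (A B D E : O) : ddR A B (T D E) ≫ sm (𝟙 A) (aT B D E) =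
    aT (S A B) D E ≫ tm (ddR A B D) (𝟙 E) ≫ ddR A (T B D) E := by
  have h1 : tm (cT D E) (𝟙 B) ≫ aT' E D B ≫ tm (𝟙 E) (cT D B) ≫ cT E (T B D) =
      cT (T D E) B ≫ aT B D E := by
    have := congrArg (fun k => cT (T D E) B ≫ k ≫ tm (𝟙 E) (cT D B) ≫ cT E (T B D)) (revT B D E)
    simpa using this
  have h2 := revT (S A B) D E
  have h3 : ddR A B D ≫ cS A (T B D) =
      cT (S A B) D ≫ tm (𝟙 D) (cS A B) ≫ d D B A ≫ sm (cT D B) (𝟙 A) := by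
    rw [dR_eq]; simp
  have h4 : tm (𝟙 E) (sm (cT D B) (𝟙 A)) ≫ d E (T B D) A =
      d E (T D B) A ≫ sm (tm (𝟙 E) (cT D B)) (𝟙 A) := by rw [d_nat]
  have h5 : aT' E D (S A B) ≫ tm (𝟙 E) (tm (𝟙 D) (cS A B)) =
      tm (𝟙 _) (cS A B) ≫ aT' E D (S B A) := by rw [← aT'_nat]; simp
  have h6 : tm (cT D E) (𝟙 (S B A)) ≫ d (T E D) B A =
      d (T D E) B A ≫ sm (tm (cT D E) (𝟙 B)) (𝟙 A) := by rw [← d_nat]; simp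
  have h7 : tm (cT D E) (𝟙 (S A B)) ≫ tm (𝟙 _) (cS A B) =
      tm (𝟙 _) (cS A B) ≫ tm (cT D E) (𝟙 _) := by simp
  symm
  calc aT (S A B) D E ≫ tm (ddR A B D) (𝟙 E) ≫ ddR A (T B D) E
      = aT (S A B) D E ≫ cT _ E ≫ tm (𝟙 E) (ddR A B D ≫ cS A (T B D)) ≫ d E (T B D) A ≫
          sm (cT _ _) (𝟙 _) ≫ cS _ _ := by
        rw [dR_eq A (T B D) E, cT_nat_a, tmR]; simp only [Category.assoc]
    _ = cT (S A B) (T D E) ≫ tm (𝟙 _) (cS A B) ≫ d (T D E) B A ≫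
          sm (tm (cT D E) (𝟙 B) ≫ aT' E D B ≫ tm (𝟙 E) (cT D B) ≫ cT E (T B D)) (𝟙 A) ≫
          cS _ _ := by
        rw [h3]
        simp only [tmR, smL, Category.assoc]
        rw [reassoc_of% h4, ← reassoc_of% h2, reassoc_of% h5, ← reassoc_of% (d_conj E D B A),
          reassoc_of% h7, reassoc_of% h6]
    _ = ddR A B (T D E) ≫ sm (𝟙 A) (aT B D E) := by
        rw [h1, dR_eq]
        simp only [smL, Category.assoc]
        rw [cS_nat]

theorem hexS2 (A B D : O) : aS B D A ≫ cS (S B D) A ≫ aS A B D =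
    sm (𝟙 B) (cS D A) ≫ aS B A D ≫ sm (cS B A) (𝟙 D) := by
  have := congrArg (fun k => (aS B D A ≫ cS (S B D) A ≫ aS A B D) ≫ k ≫
    (sm (𝟙 B) (cS D A) ≫ aS B A D ≫ sm (cS B A) (𝟙 D))) (hexS A B D)
  simpa using this.symm

theorem hexT2 (A B D : O) : aT B D A ≫ cT (T B D) A ≫ aT A B D =
    tm (𝟙 B) (cT D A) ≫ aT B A D ≫ tm (cT B A) (𝟙 D) := by
  have := congrArg (fun k => (aT B D A ≫ cT (T B D) A ≫ aT A B D) ≫ k ≫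
    (tm (𝟙 B) (cT D A) ≫ aT B A D ≫ tm (cT B A) (𝟙 D))) (hexT A B D)
  simpa using this.symm

end basics

/-- The opposite structure, exchanging the two connectives. -/
@[reducible] def opLD {O : Type} (L : LD O) : LD O where
  Hom A B := B ⟶ A
  id A := 𝟙 A
  comp f g := g ≫ f
  id_comp f := Category.comp_id f
  comp_id f := Category.id_comp f
  assoc f g h := (Category.assoc h g f).symm
  T := L.S
  S := L.T
  tm f g := L.sm f g
  sm f g := L.tm f g
  tm_id := L.sm_id
  sm_id := L.tm_id
  tm_comp f g f' g' := L.sm_comp g f g' f'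
  sm_comp f g f' g' := L.tm_comp g f g' f'
  aT := L.aS'
  aT' := L.aS
  aS := L.aT'
  aS' := L.aT
  aT_aT' := L.aS_aS'
  aT'_aT := L.aS'_aS
  aS_aS' := L.aT_aT'
  aS'_aS := L.aT'_aT
  aT_nat f g h := (aS'_nat f g h).symm
  aS_nat f g h := (aT'_nat f g h).symm
  cT A B := L.cS B A
  cS A B := L.cT B A
  cT_cT A B := L.cS_cS A B
  cS_cS A B := L.cT_cT A B
  cT_nat f g := (L.cS_nat g f).symm
  cS_nat f g := (L.cT_nat g f).symm
  hexT A B D := by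
    have := hexS2 A B D
    simp only [Category.assoc]
    exact this
  hexS A B D := by
    have := hexT2 A B D
    simp only [Category.assoc]
    exact this
  d := L.ddR
  ddR := L.d
  dR_eq A B D := by
    have := d_eq A B D
    simp only [Category.assoc]
    exact this
  d_nat f g h := (dR_nat f g h).symm
  d_conj A B D E := (dR_disj A B D E).trans (Category.assoc _ _ _).symm
  d_disj A B D E := (dR_conj A B D E).trans (Category.assoc _ _ _).symm
  d_bconj A B D E := by
    have := congrArg (fun k => k ≫ aS A (T B D) E) (L.d_bdisj A B D E)
    simp only [Category.assoc, aS'_aS, Category.comp_id] at this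
    exact this.symm.trans (Category.assoc _ _ _).symm
  d_bdisj A B D E := by
    have := congrArg (fun k => aT A (S B D) E ≫ k) (L.d_bconj A B D E)
    simp only [aT_aT'_a] at this
    exact this.symm.trans (Category.assoc _ _ _).symm

end PNProof

namespace PNProof

open CategoryTheory LD

/-- A virtual arrow from the (absent) unit of the first connective to `Z`. -/
structure Pt {O : Type} [LD O] (Z : O) where
  z : ∀ A : O, A ⟶ T A Z
  nat : ∀ {A D : O} (f : A ⟶ D), f ≫ z D = z A ≫ tm f (𝟙 Z)
  b : ∀ A B : O, z (T A B) ≫ aT' A B Z = tm (𝟙 A) (z B)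
  dl : ∀ B D : O, z (S B D) ≫ cT (S B D) Z ≫ d Z B D = sm (z B ≫ cT B Z) (𝟙 D)

/-- Virtual arrows into the (absent) unit of the second connective. -/
abbrev Cpt {O : Type} [L : LD O] (Z : O) := @Pt O (opLD L) Z

section pts
variable {O : Type} [L : LD O]

theorem Pt.ext' {Z : O} {p q : Pt Z} (h : ∀ A, p.z A = q.z A) : p = q := by
  cases p; cases q; congr; exact funext h

/-- Transport of points. -/
def Pt.map {Z W : O} (p : Pt Z) (f : Z ⟶ W) : Pt W where
  z A := p.z A ≫ tm (𝟙 A) f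
  nat g := by
    rw [reassoc_of% (p.nat g)]; simp
  b A B := by
    have h : tm (𝟙 (T A B)) f ≫ aT' A B W = aT' A B Z ≫ tm (𝟙 A) (tm (𝟙 B) f) := by
      rw [← aT'_nat]; simp
    rw [Category.assoc, h, reassoc_of% (p.b A B)]; simp
  dl B D := by
    have h : tm f (𝟙 (S B D)) ≫ d W B D = d Z B D ≫ sm (tm f (𝟙 B)) (𝟙 D) := by
      rw [← d_nat]; simp
    rw [Category.assoc, cT_nat_a, h, reassoc_of% (p.dl B D)]
    simp [cT_nat, cT_nat_a]

@[simp] theorem Pt.map_z {Z W : O} (p : Pt Z) (f : Z ⟶ W) (A : O) :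
    (p.map f).z A = p.z A ≫ tm (𝟙 A) f := rfl

theorem Pt.nat_a {Z : O} (p : Pt Z) {A D E : O} (f : A ⟶ D) (k : T D Z ⟶ E) :
    f ≫ p.z D ≫ k = p.z A ≫ tm f (𝟙 Z) ≫ k := by rw [reassoc_of% (p.nat f)]

theorem Pt.mid {Z : O} (p : Pt Z) (A W : O) :
    tm (p.z A) (𝟙 W) ≫ aT' A Z W = tm (𝟙 A) (p.z W ≫ cT W Z) := by
  have h1 : tm (p.z A) (𝟙 W) = p.z (T A W) ≫ tm (cT A W) (𝟙 _) ≫ aT' W A Z ≫ cT W (T A Z) := by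
    rw [← reassoc_of% (p.nat (cT A W)), reassoc_of% (p.b W A), cT_nat, cT_cT_a]
  rw [h1]
  simp only [Category.assoc]
  rw [hexT, tmR, ← p.b A W]
  simp

theorem Pt.dr {Z : O} (p : Pt Z) (A B : O) : p.z (S A B) ≫ ddR A B Z = sm (𝟙 A) (p.z B) := by
  rw [dR_eq, ← cT_nat_a, ← reassoc_of% (p.nat (cS A B)), reassoc_of% (p.dl B A)]
  simp [cS_nat, cS_nat_a]

theorem Pt.bl {Z : O} (p : Pt Z) (A B : O) :
    p.z (T A B) ≫ cT (T A B) Z ≫ aT Z A B = tm (p.z A ≫ cT A Z) (𝟙 B) := by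
  have h1 := congrArg (fun k => cT A B ≫ k) (p.b B A)
  simp only [p.nat_a] at h1
  have h2 := congrArg (fun k => k ≫ aT B A Z) h1
  simp only [Category.assoc, aT'_aT, Category.comp_id] at h2
  have h3 := revT Z A B
  have h4 : cT (T A B) Z ≫ aT Z A B = tm (cT A B) (𝟙 Z) ≫ aT' B A Z ≫ tm (𝟙 B) (cT A Z) ≫
      cT B (T Z A) := by
    have := congrArg (fun k => cT (T A B) Z ≫ k ≫ tm (𝟙 B) (cT A Z) ≫ cT B (T Z A)) (revT Z A B)
    simpa using this.symm
  rw [h4, reassoc_of% h1]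
  simp [cT_nat, cT_nat_a]

/-- Two points commute. -/
theorem Pt.swap {Z W : O} (p : Pt Z) (q : Pt W) (A : O) :
    p.z A ≫ tm (𝟙 A) (q.z Z) = q.z A ≫ tm (𝟙 A) (p.z W ≫ cT W Z) := by
  rw [← q.b, ← p.mid, ← reassoc_of% (q.nat (p.z A))]

end pts
end PNProof

namespace PNProof

open CategoryTheory LD

section cpts
variable {O : Type} [L : LD O]

/-- The arrows of a copoint, in the original category. -/
def rho {W : O} (w : Cpt W) (A : O) : S A W ⟶ A := @Pt.z O (opLD L) W w A

theorem rho_nat {W : O} (w : Cpt W) {A D : O} (g : D ⟶ A) :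
    sm g (𝟙 W) ≫ rho w A = rho w D ≫ g := (@Pt.nat O (opLD L) W w _ _ g).symm
theorem rho_nat_a {W : O} (w : Cpt W) {A D E : O} (g : D ⟶ A) (k : A ⟶ E) :
    sm g (𝟙 W) ≫ rho w A ≫ k = rho w D ≫ g ≫ k := by
  rw [reassoc_of% (rho_nat w g)]
theorem rho_b {W : O} (w : Cpt W) (A B : O) :
    aS A B W ≫ rho w (S A B) = sm (𝟙 A) (rho w B) := @Pt.b O (opLD L) W w A B
theorem rho_dr {W : O} (w : Cpt W) (A B : O) :
    d A B W ≫ rho w (T A B) = tm (𝟙 A) (rho w B) := @Pt.dr O (opLD L) W w A B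
theorem rho_dl {W : O} (w : Cpt W) (B D : O) :
    ddR W B D ≫ cS W (T B D) ≫ rho w (T B D) = tm (cS W B ≫ rho w B) (𝟙 D) :=
  (Category.assoc _ _ _).symm.trans (@Pt.dl O (opLD L) W w B D)
theorem rho_mid {W : O} (w : Cpt W) (A V : O) :
    aS A W V ≫ sm (rho w A) (𝟙 V) = sm (𝟙 A) (cS W V ≫ rho w V) := @Pt.mid O (opLD L) W w A V
theorem rho_bl {W : O} (w : Cpt W) (A B : O) :
    aS' W A B ≫ cS W (S A B) ≫ rho w (S A B) = sm (cS W A ≫ rho w A) (𝟙 B) :=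
  (Category.assoc _ _ _).symm.trans (@Pt.bl O (opLD L) W w A B)

/-- Transport of copoints. -/
def cmap {Z W : O} (w : Cpt Z) (f : W ⟶ Z) : Cpt W := @Pt.map O (opLD L) Z W w f

theorem rho_cmap {Z W : O} (w : Cpt Z) (f : W ⟶ Z) (A : O) :
    rho (cmap w f) A = sm (𝟙 A) f ≫ rho w A := rfl

theorem rho_ext {W : O} {p q : Cpt W} (h : ∀ A, rho p A = rho q A) : p = q :=
  @Pt.ext' O (opLD L) W p q h

def Tri1 {X Y : O} (η : Pt (S X Y)) (ε : Cpt (T Y X)) : Prop :=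
  η.z X ≫ cT X (S X Y) ≫ ddR X Y X ≫ rho ε X = 𝟙 X
def Tri2 {X Y : O} (η : Pt (S X Y)) (ε : Cpt (T Y X)) : Prop :=
  η.z Y ≫ d Y X Y ≫ cS (T Y X) Y ≫ rho ε Y = 𝟙 Y

/-- Flips. -/
def fl {X Y : O} (η : Pt (S X Y)) : Pt (S Y X) := η.map (cS X Y)
def cfl {X Y : O} (ε : Cpt (T Y X)) : Cpt (T X Y) := cmap ε (cT X Y)

theorem fl_fl {X Y : O} (η : Pt (S X Y)) : fl (fl η) = η := by
  apply Pt.ext'; intro A; simp [fl]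
theorem cfl_cfl {X Y : O} (ε : Cpt (T Y X)) : cfl (cfl ε) = ε :=
  @fl_fl O (opLD L) Y X ε

theorem tri1_iff {X Y : O} (η : Pt (S X Y)) (ε : Cpt (T Y X)) :
    Tri1 η ε ↔ Tri2 (fl η) (cfl ε) := by
  unfold Tri1 Tri2 fl cfl
  have h : sm (cT X Y) (𝟙 X) ≫ cS (T Y X) X = cS (T X Y) X ≫ sm (𝟙 X) (cT X Y) := cS_nat _ _
  rw [dR_eq, rho_cmap, Pt.map_z]
  simp only [Category.assoc]
  rw [cT_cT_a]
  rw [reassoc_of% h]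

theorem tri2_iff {X Y : O} (η : Pt (S X Y)) (ε : Cpt (T Y X)) :
    Tri2 η ε ↔ Tri1 (fl η) (cfl ε) := by
  rw [tri1_iff, fl_fl, cfl_cfl]

/-- `Tri2` is the dual of `Tri1`. -/
theorem tri1_op {X Y : O} (η : Pt (S X Y)) (ε : Cpt (T Y X)) :
    @Tri1 O (opLD L) Y X ε η ↔ Tri2 η ε := by
  unfold Tri2
  have : η.z Y ≫ d Y X Y ≫ cS (T Y X) Y ≫ rho ε Y =
    ((η.z Y ≫ d Y X Y) ≫ cS (T Y X) Y) ≫ rho ε Y := by simp only [Category.assoc]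
  rw [this]
  exact Iff.rfl

theorem tri2_op {X Y : O} (η : Pt (S X Y)) (ε : Cpt (T Y X)) :
    @Tri2 O (opLD L) Y X ε η ↔ Tri1 η ε := 
  (@tri1_op O (opLD L) Y X ε η).symm

/-- The snake. -/
theorem snake {X Y : O} {η : Pt (S X Y)} {ε : Cpt (T Y X)} (A : O) :
    tm (η.z A ≫ d A X Y) (𝟙 X) ≫ ddR (T A X) Y X ≫ rho ε (T A X) =
      tm (𝟙 A) (η.z X ≫ cT X (S X Y) ≫ ddR X Y X ≫ rho ε X) := by
  rw [tmL, Category.assoc, reassoc_of% (d_bconj A X Y X), reassoc_of% (η.mid A X), rho_dr]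
  simp

theorem Tri1.snake {X Y : O} {η : Pt (S X Y)} {ε : Cpt (T Y X)} (h : Tri1 η ε) (A : O) :
    tm (η.z A ≫ d A X Y) (𝟙 X) ≫ ddR (T A X) Y X ≫ rho ε (T A X) = 𝟙 (T A X) := by
  rw [PNProof.snake, h, tm_id]

/-- The comparison arrow. -/
def cmpr {X Y Y' : O} (ε : Cpt (T Y X)) (η' : Pt (S X Y')) : Y ⟶ Y' :=
  η'.z Y ≫ d Y X Y' ≫ cS (T Y X) Y' ≫ rho ε Y'

theorem cmpr_eta {X Y Y' : O} {η : Pt (S X Y)} {ε : Cpt (T Y X)} (h : Tri1 η ε)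
    (η' : Pt (S X Y')) : η.map (sm (𝟙 X) (cmpr ε η')) = η' := by
  apply Pt.ext'
  intro A
  have h0 : sm (𝟙 X) (cS (T Y X) Y' ≫ rho ε Y') =
      aS X (T Y X) Y' ≫ sm (rho ε X) (𝟙 _) := (rho_mid ε X Y').symm
  have h1 : sm (𝟙 X) (cmpr ε η') = η'.z (S X Y) ≫ d (S X Y) X Y' ≫ sm (ddR X Y X ≫ rho ε X) (𝟙 Y')
      := by
    unfold cmpr
    rw [smR, smR, ← η'.dr, h0]
    simp only [Category.assoc]
    rw [reassoc_of% (d_bdisj X Y X Y')]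
    simp
  have h2 := η.swap η' A
  rw [Pt.map_z, h1, tmR, reassoc_of% h2, tm_comp, Category.assoc]
  have h3 : η.z (S X Y') ≫ cT (S X Y') (S X Y) ≫ d (S X Y) X Y' ≫ sm (ddR X Y X ≫ rho ε X) (𝟙 Y')
    = 𝟙 _ := by
    rw [reassoc_of% (η.dl X Y'), sm_comp]
    unfold Tri1 at h
    simp [h]
  rw [h3]; simp

theorem cmpr_op {X Y Y' : O} (ε : Cpt (T Y X)) (η' : Pt (S X Y')) :
    @cmpr O (opLD L) X Y' Y (fl η') (cfl ε) = cmpr ε η' := by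
  have : @cmpr O (opLD L) X Y' Y (fl η') (cfl ε) =
    (((fl η').z Y ≫ cT Y (S Y' X)) ≫ ddR Y' X Y) ≫ rho (cfl ε) Y' := rfl
  rw [this, dR_eq]
  have h : sm (cT Y X) (𝟙 Y') ≫ cS (T X Y) Y' = cS _ _ ≫ sm (𝟙 _) (cT Y X) := cS_nat _ _
  unfold cmpr cfl fl
  rw [Pt.map_z, rho_cmap]
  simp only [Category.assoc]
  rw [cT_cT_a, reassoc_of% h]
  simp

theorem cmpr_eps {X Y Y' : O} (ε : Cpt (T Y X)) {η' : Pt (S X Y')} {ε' : Cpt (T Y' X)}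
    (h : Tri1 η' ε') : cmap ε' (tm (cmpr ε η') (𝟙 X)) = ε := by
  have h1 := @cmpr_eta O (opLD L) X Y' Y (cfl ε') (fl η')
    ((tri1_op (fl η') (cfl ε')).mpr ((tri1_iff η' ε').mp h)) (cfl ε)
  rw [cmpr_op] at h1
  have h2 : cmap (cfl ε') (tm (𝟙 X) (cmpr ε η')) = cfl ε := h1
  apply rho_ext
  intro A
  have h3 := congrArg (fun w => rho w A) h2
  simp only [cfl, rho_cmap] at h3
  have h4 := congrArg (fun w => sm (𝟙 A) (cT Y X) ≫ w) h3
  simp only [sm_comp_a, cT_cT, Category.comp_id, sm_id, Category.id_comp] at h4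
  rw [rho_cmap, ← h4, cT_nat, cT_cT_a]

theorem cmpr_cmpr {X Y Y' : O} {η : Pt (S X Y)} {ε : Cpt (T Y X)} {η' : Pt (S X Y')}
    {ε' : Cpt (T Y' X)} (h' : Tri1 η' ε') (h : Tri2 η ε) :
    cmpr ε η' ≫ cmpr ε' η = 𝟙 Y := by
  have h1 := cmpr_eta h' η
  have h2 := congrArg (fun p => p.z Y) h1
  have h3 : sm (𝟙 (T Y X)) (cmpr ε' η) ≫ cS (T Y X) Y = cS (T Y X) Y' ≫ sm (cmpr ε' η) (𝟙 _) :=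
    cS_nat _ _
  have h4 : tm (𝟙 Y) (sm (𝟙 X) (cmpr ε' η)) ≫ d Y X Y = d Y X Y' ≫ sm (𝟙 _) (cmpr ε' η) := by
    rw [d_nat]; simp
  rw [Pt.map_z] at h2
  conv_lhs => arg 1; unfold cmpr
  simp only [Category.assoc]
  rw [← rho_nat, ← reassoc_of% h3, ← reassoc_of% h4, reassoc_of% h2]
  exact h

end cpts
end PNProof

namespace PNProof

open CategoryTheory LD

section conj
variable {O : Type} [L : LD O]

/-- The point of the conjunction of two dual pairs. -/
def kmap (C C' : O) {D D' : O} (q : Pt (S D D')) : S C C' ⟶ S (T C D) (S C' D') :=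
  sm (q.z C ≫ d C D D') (𝟙 C') ≫ aS' (T C D) D' C' ≫ sm (𝟙 _) (cS D' C')

def K {C C' D D' : O} (p : Pt (S C C')) (q : Pt (S D D')) : Pt (S (T C D) (S C' D')) :=
  p.map (kmap C C' q)

theorem K_d {C C' D D' : O} (p : Pt (S C C')) (q : Pt (S D D')) (A : O) :
    (K p q).z A ≫ d A (T C D) (S C' D') =
      p.z A ≫ d A C C' ≫
        sm (q.z (T A C) ≫ d (T A C) D D' ≫ sm (aT' A C D) (𝟙 D')) (𝟙 C') ≫
        aS' (T A (T C D)) D' C' ≫ sm (𝟙 _) (cS D' C') := by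
  unfold K kmap
  rw [Pt.map_z]
  have h1 : tm (𝟙 A) (sm (𝟙 (T C D)) (cS D' C')) ≫ d A (T C D) (S C' D') =
      d _ _ _ ≫ sm (𝟙 _) (cS D' C') := by rw [d_nat]; simp
  have h2 : ∀ {U : O} (f : C ⟶ U), tm (𝟙 A) (sm f (𝟙 C')) ≫ d A U C' =
      d _ _ _ ≫ sm (tm (𝟙 A) f) (𝟙 _) := by intro U f; rw [d_nat]
  have h3 : sm (tm (𝟙 A) (q.z C ≫ d C D D')) (𝟙 C') ≫ sm (d A (T C D) D') (𝟙 C') =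
      sm (q.z (T A C) ≫ d (T A C) D D' ≫ sm (aT' A C D) (𝟙 D')) (𝟙 C') := by
    rw [sm_comp, d_conj, reassoc_of% (q.b A C)]
    simp
  simp only [tmR, Category.assoc]
  rw [h1, reassoc_of% (d_disj A (T C D) D' C'), 
    reassoc_of% (h2 (q.z C ≫ d C D D')), reassoc_of% h3]

theorem cT_d (C D D' : O) : cT (S D D') C ≫ d C D D' =
    tm (cS D D') (𝟙 C) ≫ ddR D' D C ≫ cS _ _ ≫ sm (cT D C) (𝟙 D') := by
  rw [dR_eq]
  simp only [Category.assoc]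
  rw [cT_nat_a]
  simp

theorem E_coh (C C' D D' : O) :
    cT (S C C') (S D D') ≫ d (S D D') C C' ≫ sm (cT (S D D') C ≫ d C D D') (𝟙 C') ≫
        aS' (T C D) D' C' ≫ sm (𝟙 _) (cS D' C') =
      d (S C C') D D' ≫ sm (cT (S C C') D ≫ d D C C') (𝟙 D') ≫ aS' (T D C) C' D' ≫
        sm (cT D C) (𝟙 _) := by
  have h1 : tm (cS D D') (𝟙 (S C C')) ≫ d (S D' D) C C' =
      d (S D D') C C' ≫ sm (tm (cS D D') (𝟙 C)) (𝟙 C') := by rw [← d_nat]; simp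
  have h2 : sm (sm (cT D C) (𝟙 D')) (𝟙 C') ≫ aS' (T C D) D' C' =
      aS' (T D C) D' C' ≫ sm (cT D C) (𝟙 _) := by rw [aS'_nat]; simp
  have h3 : cT (S C C') (S D D') ≫ tm (cS D D') (𝟙 (S C C')) ≫ ddR D' D (S C C') =
      d (S C C') D D' ≫ sm (cT (S C C') D) (𝟙 D') ≫ cS (T D (S C C')) D' := by
    rw [dR_eq, cT_nat_a]; simp
  have h4 := d_bdisj D' D C C'
  have h5 : sm (ddR D' D C) (𝟙 C') = sm (ddR D' D C) (𝟙 C') ≫ aS' D' (T D C) C' ≫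
      aS D' (T D C) C' := by simp
  have h6 : sm (cS D' (T D C)) (𝟙 C') ≫ aS' (T D C) D' C' ≫ sm (𝟙 (T D C)) (cS D' C') = _ :=
    (hexS D' (T D C) C').symm
  rw [cT_d]
  simp only [smL, Category.assoc]
  rw [reassoc_of% h2, ← reassoc_of% h1, reassoc_of% h5, ← reassoc_of% h4, reassoc_of% h3]
  have h7 : sm (cT D C) (𝟙 (S D' C')) ≫ sm (𝟙 _) (cS D' C') = sm (𝟙 _) (cS D' C') ≫
    sm (cT D C) (𝟙 _) := by simp
  rw [h7, reassoc_of% h6, aS_aS'_a, ← cS_nat_a, cS_cS_a]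

theorem kmap_eq (C C' : O) {D D' : O} (q : Pt (S D D')) :
    kmap C C' q = q.z (S C C') ≫ cT (S C C') (S D D') ≫ d (S D D') C C' ≫
      sm (cT (S D D') C ≫ d C D D') (𝟙 C') ≫ aS' (T C D) D' C' ≫ sm (𝟙 _) (cS D' C') := by
  rw [reassoc_of% (q.dl C C')]
  unfold kmap
  simp

/-- Interchange: the two orders of forming the conjunction agree. -/
theorem K_swap {C C' D D' : O} (p : Pt (S C C')) (q : Pt (S D D')) :
    K p q = (K q p).map (sm (cT D C) (cS D' C')) := by
  apply Pt.ext'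
  intro A
  unfold K
  rw [kmap_eq, E_coh, kmap_eq]
  simp only [Pt.map_z, Category.assoc]
  rw [tmR, reassoc_of% (p.swap q A)]
  simp

def Kc {C C' D D' : O} (p : Cpt (T C' C)) (q : Cpt (T D' D)) : Cpt (T (S C' D') (T C D)) :=
  @K O (opLD L) C' C D' D p q

theorem Kc_swap {C C' D D' : O} (p : Cpt (T C' C)) (q : Cpt (T D' D)) :
    Kc p q = cmap (Kc q p) (tm (cS C' D') (cT C D)) :=
  @K_swap O (opLD L) C' C D' D p q

/-- The second form of the conjunction of copoints. -/
theorem rho_K_d {C C' D D' : O} (p : Cpt (T C' C)) (q : Cpt (T D' D)) (A : O) :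
    ddR A (S C' D') (T C D) ≫ rho (Kc p q) A =
      tm (𝟙 _) (cT C D) ≫ aT (S A (S C' D')) D C ≫
        tm (tm (aS A C' D') (𝟙 D) ≫ ddR (S A C') D' D ≫ rho q (S A C')) (𝟙 C) ≫ ddR A C' C ≫
        rho p A := by
  have := @K_d O (opLD L) C' C D' D p q A
  have h : tm (tm (aS A C' D') (𝟙 D) ≫ ddR (S A C') D' D ≫ rho q (S A C')) (𝟙 C) =
    tm ((tm (aS A C' D') (𝟙 D) ≫ ddR (S A C') D' D) ≫ rho q (S A C')) (𝟙 C) := by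
      rw [Category.assoc]
  rw [h]
  simp only [← Category.assoc]
  exact this

theorem tri1_K {C C' D D' : O} {p : Pt (S C C')} {p' : Cpt (T C' C)} {q : Pt (S D D')}
    {q' : Cpt (T D' D)} (hp : Tri1 p p') (hq : Tri1 q q') :
    Tri1 (K p q) (Kc p' q') := by
  rw [Kc_swap]
  have key : ∀ A : O, tm ((K p q).z A ≫ d A (T C D) (S C' D')) (𝟙 (T C D)) ≫
      ddR (T A (T C D)) (S C' D') (T C D) ≫
      rho (cmap (Kc q' p') (tm (cS C' D') (cT C D))) (T A (T C D)) = 𝟙 _ := by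
    intro A
    rw [rho_cmap, ← dR_nat_a, tm_comp_a, rho_K_d, K_d]
    have ha : ∀ {U V : O} (f : U ⟶ V), tm f (𝟙 (T C D)) ≫ aT V C D =
        aT U C D ≫ tm (tm f (𝟙 C)) (𝟙 D) := by
      intro U V f; rw [← aT_nat]; simp
    have hb : ∀ {V : O} (H : T A C ⟶ V), tm (p.z A ≫ d A C C' ≫ sm H (𝟙 C')) (𝟙 C) ≫
        ddR V C' C ≫ rho p' V = H := by
      intro V H
      rw [← Category.assoc (p.z A), tmL, Category.assoc, dR_nat_a, tm_id, rho_nat,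
        ← Category.assoc (ddR _ _ _), ← Category.assoc (tm _ _), hp.snake, Category.id_comp]
    have hc : tm (q.z (T A C) ≫ d (T A C) D D' ≫ sm (aT' A C D) (𝟙 D')) (𝟙 D) ≫
        ddR _ D' D ≫ rho q' _ = aT' A C D := by
      rw [← Category.assoc (q.z _), tmL, Category.assoc, dR_nat_a, tm_id, rho_nat,
        ← Category.assoc (ddR _ _ _), ← Category.assoc (tm _ _), hq.snake, Category.id_comp]
    simp only [tm_comp_a, Category.assoc, sm_comp, cS_cS, cT_cT, Category.id_comp, sm_id,
      Category.comp_id]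
    rw [reassoc_of% ha, tm_comp_a, tm_comp_a]
    simp only [Category.assoc, aS'_aS, Category.comp_id]
    rw [hb, hc, aT_aT']
  have key2 : ∀ A : O, _ := fun A => (snake (η := K p q)
    (ε := cmap (Kc q' p') (tm (cS C' D') (cT C D))) A).symm.trans (key A)
  unfold Tri1
  set t := (K p q).z (T C D) ≫ cT (T C D) (S (T C D) (S C' D')) ≫ ddR (T C D) (S C' D') (T C D) ≫
    rho (cmap (Kc q' p') (tm (cS C' D') (cT C D))) (T C D) with ht
  have h1 : t ≫ q.z (T C D) ≫ cT _ _ = q.z (T C D) ≫ cT _ _ := by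
    rw [reassoc_of% (q.nat t), cT_nat, key2]; simp
  have h2 : q.z (T C D) ≫ aT' C D (S D D') ≫ tm (𝟙 C) (cT D _ ≫ ddR D D' D ≫ rho q' D) = 𝟙 _ := by
    rw [reassoc_of% (q.b C D), tm_comp]
    unfold Tri1 at hq
    rw [hq]; simp
  have h3 := congrArg (fun k => k ≫ cT _ _ ≫ aT' C D (S D D') ≫
    tm (𝟙 C) (cT D _ ≫ ddR D D' D ≫ rho q' D)) h1
  simp only [Category.assoc, cT_cT_a] at h3
  rw [h2] at h3
  simpa using h3

end conj
end PNProof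

namespace PNProof

open CategoryTheory LD

section disj
variable {O : Type} [L : LD O]

theorem tri2_K {C C' D D' : O} {p : Pt (S C C')} {p' : Cpt (T C' C)} {q : Pt (S D D')}
    {q' : Cpt (T D' D)} (hp : Tri2 p p') (hq : Tri2 q q') :
    Tri2 (K p q) (Kc p' q') :=
  (tri1_op (K p q) (Kc p' q')).mp
    (@tri1_K O (opLD L) C' C D' D p' p q' q ((tri1_op p p').mpr hp) ((tri1_op q q').mpr hq))

/-- The point of the disjunction of two dual pairs. -/
def Kd {C C' D D' : O} (p : Pt (S C C')) (q : Pt (S D D')) : Pt (S (S C D) (T C' D')) :=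
  q.map (sm (𝟙 D) (p.z D' ≫ cT D' (S C C') ≫ ddR C C' D') ≫ aS D C (T C' D') ≫
    sm (cS D C) (𝟙 _))

theorem Kd_eq {C C' D D' : O} (p : Pt (S C C')) (q : Pt (S D D')) :
    Kd p q = fl (K (fl p) (fl q)) := by
  rw [K_swap]
  apply Pt.ext'
  intro A
  unfold Kd fl K kmap
  simp only [Pt.map_z, Category.assoc, tm_comp, Category.comp_id, sm_comp, cS_cS, Category.id_comp]
  congr 2
  have h1 := revS D C (T C' D')
  have h2 : sm (cT D' C') (𝟙 (S C D)) ≫ cS _ _ = cS _ _ ≫ sm (𝟙 _) (cT D' C') := cS_nat _ _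
  have h3 : aS' (T D' C') C D ≫ sm (cT D' C') (𝟙 (S C D)) =
    sm (sm (cT D' C') (𝟙 C)) (𝟙 D) ≫ aS' _ _ _ := by rw [aS'_nat]; simp
  have h4 : aS D C (T C' D') ≫ sm (cS D C) (𝟙 (T C' D')) =
     cS D (S C (T C' D')) ≫ sm (cS C (T C' D')) (𝟙 D) ≫ aS' (T C' D') C D ≫
       cS (T C' D') (S C D) := by
    have := congrArg (fun k => k ≫ cS (T C' D') (S C D)) h1
    simp only [Category.assoc, cS_nat, cS_cS_a] at this
    rw [this]
  rw [reassoc_of% h3, cT_dR, h4, cS_nat_a]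
  simp

theorem K_map {C C' D D' E E' F F' : O} (p : Pt (S C C')) (q : Pt (S D D'))
    (f : C ⟶ E) (f' : C' ⟶ E') (g : D ⟶ F) (g' : D' ⟶ F') :
    K (p.map (sm f f')) (q.map (sm g g')) = (K p q).map (sm (tm f g) (sm f' g')) := by
  apply Pt.ext'
  intro A
  unfold K kmap
  have h1 : f ≫ q.z E ≫ tm (𝟙 E) (sm g g') ≫ d E F F' =
    q.z C ≫ d C D D' ≫ sm (tm f g) g' := by
    rw [q.nat_a, tm_comp_a, Category.comp_id, Category.id_comp, d_nat]
  have h2 : sm (sm (tm f g) g') f' ≫ aS' (T E F) F' E' = aS' _ _ _ ≫ sm (tm f g) (sm g' f') :=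
    aS'_nat _ _ _
  have h3 : sm (f ≫ q.z E ≫ tm (𝟙 E) (sm g g') ≫ d E F F') f' =
      sm (q.z C ≫ d C D D') (𝟙 _) ≫ sm (sm (tm f g) g') f' := by
    rw [h1]; simp
  simp only [Pt.map_z, Category.assoc, tm_comp, sm_comp_a, Category.comp_id]
  rw [h3]
  simp only [Category.assoc]
  rw [reassoc_of% h2]
  simp [cS_nat]

theorem fl_map {X Y X' Y' : O} (p : Pt (S X Y)) (f : X ⟶ X') (g : Y ⟶ Y') :
    fl (p.map (sm f g)) = (fl p).map (sm g f) := by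
  apply Pt.ext'
  intro A
  unfold fl
  simp [cS_nat]

theorem Kd_map {C C' D D' E E' F F' : O} (p : Pt (S C C')) (q : Pt (S D D'))
    (f : C ⟶ E) (f' : C' ⟶ E') (g : D ⟶ F) (g' : D' ⟶ F') :
    Kd (p.map (sm f f')) (q.map (sm g g')) = (Kd p q).map (sm (sm f g) (tm f' g')) := by
  simp only [Kd_eq, fl_map, K_map]

def Kcd {C C' D D' : O} (p : Cpt (T C' C)) (q : Cpt (T D' D)) : Cpt (T (T C' D') (S C D)) :=
  @Kd O (opLD L) C' C D' D p q

theorem Kcd_eq {C C' D D' : O} (p : Cpt (T C' C)) (q : Cpt (T D' D)) :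
    Kcd p q = cfl (Kc (cfl p) (cfl q)) := @Kd_eq O (opLD L) C' C D' D p q

theorem tri1_Kd {C C' D D' : O} {p : Pt (S C C')} {p' : Cpt (T C' C)} {q : Pt (S D D')}
    {q' : Cpt (T D' D)} (hp : Tri1 p p') (hq : Tri1 q q') :
    Tri1 (Kd p q) (Kcd p' q') := by
  rw [Kd_eq, Kcd_eq, ← tri2_iff]
  exact tri2_K ((tri1_iff _ _).mp hp) ((tri1_iff _ _).mp hq)

theorem tri2_Kd {C C' D D' : O} {p : Pt (S C C')} {p' : Cpt (T C' C)} {q : Pt (S D D')}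
    {q' : Cpt (T D' D)} (hp : Tri2 p p') (hq : Tri2 q q') :
    Tri2 (Kd p q) (Kcd p' q') := by
  rw [Kd_eq, Kcd_eq, ← tri1_iff]
  exact tri1_K ((tri2_iff _ _).mp hp) ((tri2_iff _ _).mp hq)

theorem Kc_cmap {C C' D D' E E' F F' : O} (p : Cpt (T C' C)) (q : Cpt (T D' D))
    (f : E ⟶ C) (f' : E' ⟶ C') (g : F ⟶ D) (g' : F' ⟶ D') :
    Kc (cmap p (tm f' f)) (cmap q (tm g' g)) = cmap (Kc p q) (tm (sm f' g') (tm f g)) :=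
  @K_map O (opLD L) C' C D' D E' E F' F p q f' f g' g

theorem Kcd_cmap {C C' D D' E E' F F' : O} (p : Cpt (T C' C)) (q : Cpt (T D' D))
    (f : E ⟶ C) (f' : E' ⟶ C') (g : F ⟶ D) (g' : F' ⟶ D') :
    Kcd (cmap p (tm f' f)) (cmap q (tm g' g)) = cmap (Kcd p q) (tm (tm f' g') (sm f g)) :=
  @Kd_map O (opLD L) C' C D' D E' E F' F p q f' f g' g

theorem cfl_cmap {X Y X' Y' : O} (p : Cpt (T Y X)) (f : X' ⟶ X) (g : Y' ⟶ Y) :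
    cfl (cmap p (tm g f)) = cmap (cfl p) (tm f g) := @fl_map O (opLD L) Y X Y' X' p g f

/-- A dual pair. -/
structure DP (X Y : O) where
  η : Pt (S X Y)
  ε : Cpt (T Y X)
  t1 : Tri1 η ε
  t2 : Tri2 η ε

def DP.flip {X Y : O} (a : DP X Y) : DP Y X :=
  ⟨fl a.η, cfl a.ε, (tri2_iff _ _).mp a.t2, (tri1_iff _ _).mp a.t1⟩

def DP.conj {X Y X' Y' : O} (a : DP X Y) (b : DP X' Y') : DP (T X X') (S Y Y') :=
  ⟨K a.η b.η, Kc a.ε b.ε, tri1_K a.t1 b.t1, tri2_K a.t2 b.t2⟩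

def DP.disj {X Y X' Y' : O} (a : DP X Y) (b : DP X' Y') : DP (S X X') (T Y Y') :=
  ⟨Kd a.η b.η, Kcd a.ε b.ε, tri1_Kd a.t1 b.t1, tri2_Kd a.t2 b.t2⟩

def DP.to {X Y Y' : O} (a : DP X Y) (b : DP X Y') : Y ⟶ Y' := cmpr a.ε b.η

theorem DP.to_to {X Y Y' : O} (a : DP X Y) (b : DP X Y') : a.to b ≫ b.to a = 𝟙 Y :=
  cmpr_cmpr b.t1 a.t2
theorem DP.to_η {X Y Y' : O} (a : DP X Y) (b : DP X Y') : a.η.map (sm (𝟙 X) (a.to b)) = b.η :=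
  cmpr_eta a.t1 _
theorem DP.to_ε {X Y Y' : O} (a : DP X Y) (b : DP X Y') : cmap b.ε (tm (a.to b) (𝟙 X)) = a.ε :=
  cmpr_eps _ b.t1

theorem Pt.map_map {Z W V : O} (p : Pt Z) (f : Z ⟶ W) (g : W ⟶ V) :
    (p.map f).map g = p.map (f ≫ g) := by
  apply Pt.ext'; intro A; simp
theorem cmap_cmap {Z W V : O} (p : Cpt Z) (f : W ⟶ Z) (g : V ⟶ W) :
    cmap (cmap p f) g = cmap p (g ≫ f) := @Pt.map_map O (opLD L) _ _ _ p f g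

/-- Compatibility of arrows with dual pairs. -/
structure Compat {X Y X' Y' : O} (a : DP X Y) (b : DP X' Y') (f : X ⟶ X') (g : Y ⟶ Y') :
    Prop where
  η : a.η.map (sm f g) = b.η
  ε : cmap b.ε (tm g f) = a.ε

theorem Compat.flip {X Y X' Y' : O} {a : DP X Y} {b : DP X' Y'} {f : X ⟶ X'} {g : Y ⟶ Y'}
    (h : Compat a b f g) : Compat a.flip b.flip g f where
  η := by
    simp only [DP.flip]
    rw [← h.η, fl_map]
  ε := by
    simp only [DP.flip]
    rw [← h.ε, cfl_cmap]

theorem Compat.conj {X Y X' Y' : O} {a : DP X Y} {b : DP X' Y'} {f : X ⟶ X'} {g : Y ⟶ Y'}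
    {U V U' V' : O} {c : DP U V} {e : DP U' V'} {k : U ⟶ U'} {l : V ⟶ V'}
    (h : Compat a b f g) (h' : Compat c e k l) :
    Compat (a.conj c) (b.conj e) (tm f k) (sm g l) where
  η := by
    simp only [DP.conj]
    rw [← h.η, ← h'.η, K_map]
  ε := by
    simp only [DP.conj]
    rw [← h.ε, ← h'.ε, Kc_cmap]

theorem Compat.disj {X Y X' Y' : O} {a : DP X Y} {b : DP X' Y'} {f : X ⟶ X'} {g : Y ⟶ Y'}
    {U V U' V' : O} {c : DP U V} {e : DP U' V'} {k : U ⟶ U'} {l : V ⟶ V'}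
    (h : Compat a b f g) (h' : Compat c e k l) :
    Compat (a.disj c) (b.disj e) (sm f k) (tm g l) where
  η := by
    simp only [DP.disj]
    rw [← h.η, ← h'.η, Kd_map]
  ε := by
    simp only [DP.disj]
    rw [← h.ε, ← h'.ε, Kcd_cmap]

theorem Compat.to {X Y Y' : O} (a : DP X Y) (b : DP X Y') : Compat a b (𝟙 X) (a.to b) :=
  ⟨a.to_η b, a.to_ε b⟩

theorem Compat.comp {X Y X' Y' X'' Y'' : O} {a : DP X Y} {b : DP X' Y'} {c : DP X'' Y''}
    {f : X ⟶ X'} {g : Y ⟶ Y'} {f' : X' ⟶ X''} {g' : Y' ⟶ Y''}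
    (h : Compat a b f g) (h' : Compat b c f' g') : Compat a c (f ≫ f') (g ≫ g') where
  η := by rw [← h'.η, ← h.η, Pt.map_map, sm_comp]
  ε := by rw [← h.ε, ← h'.ε, cmap_cmap, tm_comp]

end disj
end PNProof

namespace PNProof

open CategoryTheory LD

section inst
variable {P : Type}

/-- Arrows of the category. -/
abbrev Ar (A B : Form P) := Quot (@Eqv P A B)

def qcomp {A B C : Form P} (f : Ar A B) (g : Ar B C) : Ar A C :=
  Quot.map₂ (fun f g => Term.comp g f) (fun _ _ _ h => Eqv.congComp h (Eqv.refl _))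
    (fun _ _ _ h => Eqv.congComp (Eqv.refl _) h) f g
instance instCat : Category.{0} (Form P) where
  Hom A B := Ar A B
  id A := Quot.mk _ (Term.id A)
  comp f g := qcomp f g
  id_comp := by rintro _ _ ⟨f⟩; exact Quot.sound (Eqv.catIdR f)
  comp_id := by rintro _ _ ⟨f⟩; exact Quot.sound (Eqv.catIdL f)
  assoc := by rintro _ _ _ _ ⟨f⟩ ⟨g⟩ ⟨h⟩; exact Quot.sound (Eqv.catAssoc f g h)
def q {A B : Form P} (f : Term P A B) : A ⟶ B := Quot.mk _ f

def qconj {A B D E : Form P} (f : A ⟶ D) (g : B ⟶ E) : (A ⋏ B) ⟶ (D ⋏ E) :=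
  Quot.map₂ Term.conj (fun _ _ _ h => Eqv.congConj (Eqv.refl _) h)
    (fun _ _ _ h => Eqv.congConj h (Eqv.refl _)) f g
def qdisj {A B D E : Form P} (f : A ⟶ D) (g : B ⟶ E) : (A ⋎ B) ⟶ (D ⋎ E) :=
  Quot.map₂ Term.disj (fun _ _ _ h => Eqv.congDisj (Eqv.refl _) h)
    (fun _ _ _ h => Eqv.congDisj h (Eqv.refl _)) f g

theorem eqv_equiv (A B : Form P) : Equivalence (@Eqv P A B) :=
  ⟨Eqv.refl, Eqv.symm, Eqv.trans⟩

theorem q_eq {A B : Form P} {f g : Term P A B} : q f = q g ↔ Eqv f g :=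
  ⟨fun h => (eqv_equiv A B).eqvGen_iff.mp (Quot.eqvGen_exact h), fun h => Quot.sound h⟩


theorem q_comp {A B C : Form P} (f : Term P A B) (g : Term P B C) : q (g ⬝ f) = q f ≫ q g := rfl
theorem q_id (A : Form P) : q (Term.id A) = 𝟙 A := rfl
theorem q_conj {A B D E : Form P} (f : Term P A D) (g : Term P B E) :
    q (f ⊼ g) = qconj (q f) (q g) := rfl
theorem q_disj {A B D E : Form P} (f : Term P A D) (g : Term P B E) :
    q (f ⊽ g) = qdisj (q f) (q g) := rfl

theorem q_dR (A B D : Form P) : q (dR A B D) = q (Term.cConj (A ⋎ B) D) ≫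
    qconj (𝟙 D) (q (Term.cDisj B A)) ≫ q (Term.d D B A) ≫ qdisj (q (Term.cConj D B)) (𝟙 A) ≫
    q (Term.cDisj A (B ⋏ D)) := by
  simp only [dR, q_comp, q_conj, q_disj, q_id, Category.assoc]

theorem qconj_comp {A B D A' B' D' : Form P} (f : A ⟶ B) (g : B ⟶ D) (f' : A' ⟶ B')
    (g' : B' ⟶ D') :
    (qconj f f' : (A ⋏ A') ⟶ (B ⋏ B')) ≫ qconj g g' = qconj (f ≫ g) (f' ≫ g') := by
  revert f g f' g'
  rintro ⟨f⟩ ⟨g⟩ ⟨f'⟩ ⟨g'⟩; exact Quot.sound (Eqv.conjTwo g f g' f').symm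
theorem qdisj_comp {A B D A' B' D' : Form P} (f : A ⟶ B) (g : B ⟶ D) (f' : A' ⟶ B')
    (g' : B' ⟶ D') :
    (qdisj f f' : (A ⋎ A') ⟶ (B ⋎ B')) ≫ qdisj g g' = qdisj (f ≫ g) (f' ≫ g') := by
  revert f g f' g'
  rintro ⟨f⟩ ⟨g⟩ ⟨f'⟩ ⟨g'⟩; exact Quot.sound (Eqv.disjTwo g f g' f').symm

theorem q_hexT (A B D : Form P) : q (Term.bConjFrom A B D) ≫ q (Term.cConj A (B ⋏ D)) ≫
    q (Term.bConjFrom B D A) = qconj (q (Term.cConj A B)) (𝟙 D) ≫ q (Term.bConjFrom B A D) ≫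
      qconj (𝟙 B) (q (Term.cConj A D)) := by
  have h := q_eq.mpr (Eqv.bcConj A B D)
  simp only [q_comp, q_conj, q_id, Category.assoc] at h
  have h1 : q (Term.cConj A B) ≫ q (Term.cConj B A) = 𝟙 _ := Quot.sound (Eqv.cConjIso A B)
  have h2 : q (Term.cConj D A) ≫ q (Term.cConj A D) = 𝟙 _ := Quot.sound (Eqv.cConjIso D A)
  have h3 : ∀ A B : Form P, (qconj (𝟙 A) (𝟙 B) : (A ⋏ B) ⟶ _) = 𝟙 _ :=
    fun A B => Quot.sound (Eqv.conjOne A B)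
  rw [← h]
  simp only [Category.assoc]
  rw [qconj_comp, h2, Category.comp_id, h3, reassoc_of% (qconj_comp (A := _)), h1, Category.comp_id,
    h3]
  simp only [Category.comp_id, Category.id_comp]

theorem q_hexS (A B D : Form P) : q (Term.bDisjFrom A B D) ≫ q (Term.cDisj (B ⋎ D) A) ≫
    q (Term.bDisjFrom B D A) = qdisj (q (Term.cDisj B A)) (𝟙 D) ≫ q (Term.bDisjFrom B A D) ≫
      qdisj (𝟙 B) (q (Term.cDisj D A)) := by
  have h := q_eq.mpr (Eqv.bcDisj A B D)
  simp only [q_comp, q_disj, q_id, Category.assoc] at h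
  have h1 : q (Term.cDisj B A) ≫ q (Term.cDisj A B) = 𝟙 _ := Quot.sound (Eqv.cDisjIso A B)
  have h2 : q (Term.cDisj A D) ≫ q (Term.cDisj D A) = 𝟙 _ := Quot.sound (Eqv.cDisjIso D A)
  have h3 : ∀ A B : Form P, (qdisj (𝟙 A) (𝟙 B) : (A ⋎ B) ⟶ _) = 𝟙 _ :=
    fun A B => Quot.sound (Eqv.disjOne A B)
  rw [← h]
  simp only [Category.assoc]
  rw [qdisj_comp, h2, Category.comp_id, h3, reassoc_of% (qdisj_comp (A := _)), h1, Category.comp_id,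
    h3]
  simp only [Category.comp_id, Category.id_comp]

theorem q_bdisj (A B D E : Form P) : q (dR A B (D ⋎ E)) ≫ qdisj (𝟙 A) (q (Term.d B D E)) =
    q (Term.d (A ⋎ B) D E) ≫ qdisj (q (dR A B D)) (𝟙 E) ≫ q (Term.bDisjFrom A (B ⋏ D) E) := by
  have h := q_eq.mpr (Eqv.dBDisj A B D E)
  simp only [q_comp, q_disj, q_id, Category.assoc] at h
  exact h

theorem q_bconj (A B D E : Form P) : qconj (q (Term.d A B D)) (𝟙 E) ≫ q (dR (A ⋏ B) D E) =
    q (Term.bConjFrom A (B ⋎ D) E) ≫ qconj (𝟙 A) (q (dR B D E)) ≫ q (Term.d A B (D ⋏ E)) := by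
  have h := q_eq.mpr (Eqv.dBConj A B D E)
  simp only [q_comp, q_conj, q_id, Category.assoc] at h
  exact h

theorem q_ddisj (A B D E : Form P) : qconj (𝟙 A) (q (Term.bDisjFrom B D E)) ≫
    q (Term.d A B (D ⋎ E)) = q (Term.d A (B ⋎ D) E) ≫ qdisj (q (Term.d A B D)) (𝟙 E) ≫
      q (Term.bDisjFrom (A ⋏ B) D E) := by
  have h := q_eq.mpr (Eqv.dDisj A B D E)
  simp only [q_comp, q_conj, q_disj, q_id, Category.assoc] at h
  exact h

theorem q_dconj (A B D E : Form P) : q (Term.d (A ⋏ B) D E) ≫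
    qdisj (q (Term.bConjFrom A B D)) (𝟙 E) = q (Term.bConjFrom A B (D ⋎ E)) ≫
      qconj (𝟙 A) (q (Term.d B D E)) ≫ q (Term.d A (B ⋏ D) E) := by
  have h := q_eq.mpr (Eqv.dConj A B D E)
  simp only [q_comp, q_conj, q_disj, q_id, Category.assoc] at h
  exact h

instance instLD : LD (Form P) where
  T := Form.conj
  S := Form.disj
  tm f g := qconj f g
  sm f g := qdisj f g
  tm_id A B := Quot.sound (Eqv.conjOne A B)
  sm_id A B := Quot.sound (Eqv.disjOne A B)
  tm_comp := by
    rintro _ _ _ _ _ _ ⟨f⟩ ⟨g⟩ ⟨f'⟩ ⟨g'⟩; exact Quot.sound (Eqv.conjTwo g f g' f').symm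
  sm_comp := by
    rintro _ _ _ _ _ _ ⟨f⟩ ⟨g⟩ ⟨f'⟩ ⟨g'⟩; exact Quot.sound (Eqv.disjTwo g f g' f').symm
  aT A B D := q (Term.bConjTo A B D)
  aT' A B D := q (Term.bConjFrom A B D)
  aS A B D := q (Term.bDisjTo A B D)
  aS' A B D := q (Term.bDisjFrom A B D)
  aT_aT' A B D := Quot.sound (Eqv.bConjIso₁ A B D)
  aT'_aT A B D := Quot.sound (Eqv.bConjIso₂ A B D)
  aS_aS' A B D := Quot.sound (Eqv.bDisjIso₁ A B D)
  aS'_aS A B D := Quot.sound (Eqv.bDisjIso₂ A B D)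
  aT_nat := by
    rintro _ _ _ _ _ _ ⟨f⟩ ⟨g⟩ ⟨h⟩; exact Quot.sound (Eqv.bConjNat f g h).symm
  aS_nat := by
    rintro _ _ _ _ _ _ ⟨f⟩ ⟨g⟩ ⟨h⟩; exact Quot.sound (Eqv.bDisjNat f g h).symm
  cT A B := q (Term.cConj A B)
  cS A B := q (Term.cDisj B A)
  cT_cT A B := Quot.sound (Eqv.cConjIso A B)
  cS_cS A B := Quot.sound (Eqv.cDisjIso A B)
  cT_nat := by rintro _ _ _ _ ⟨f⟩ ⟨g⟩; exact Quot.sound (Eqv.cConjNat f g).symm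
  cS_nat := by rintro _ _ _ _ ⟨f⟩ ⟨g⟩; exact Quot.sound (Eqv.cDisjNat f g).symm
  hexT := q_hexT
  hexS := q_hexS
  d A B D := q (Term.d A B D)
  ddR A B D := q (dR A B D)
  dR_eq := q_dR
  d_nat := by
    rintro _ _ _ _ _ _ ⟨f⟩ ⟨g⟩ ⟨h⟩; exact Quot.sound (Eqv.dNat f g h).symm
  d_conj := q_dconj
  d_disj := q_ddisj
  d_bconj := q_bconj
  d_bdisj := q_bdisj

end inst
end PNProof

namespace PNProof

open CategoryTheory LD

section gen
variable {O : Type} [L : LD O]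

def mkCpt {W : O} (l : ∀ A, S W A ⟶ A)
    (hn : ∀ {A D : O} (g : A ⟶ D), l A ≫ g = sm (𝟙 W) g ≫ l D)
    (hb : ∀ B A : O, aS' W B A ≫ l (S B A) = sm (l B) (𝟙 A))
    (hd : ∀ C B : O, d C B W ≫ cS (T C B) W ≫ l (T C B) = tm (𝟙 C) (cS B W ≫ l B)) : Cpt W :=
  have h1 : ∀ {A D : O} (g : D ⟶ A), (cS D W ≫ l D) ≫ g = sm g (𝟙 W) ≫ cS A W ≫ l A := by
    intro A D g
    rw [cS_nat_a, Category.assoc, hn]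
  have h2 : ∀ A B : O, aS A B W ≫ cS (S A B) W ≫ l (S A B) = sm (𝟙 A) (cS B W ≫ l B) := by
    intro A B
    have h : l (S A B) = sm (𝟙 _) (cS A B) ≫ l (S B A) ≫ cS B A := by
      rw [← reassoc_of% (hn (cS A B))]; simp
    have h' := revS A B W
    rw [h, ← reassoc_of% h', reassoc_of% (hb B A)]
    simp [cS_nat, cS_nat_a]
  have h3 : ∀ B D : O, ddR W B D ≫ cS W (T B D) ≫ cS (T B D) W ≫ l (T B D) =
      tm (cS W B ≫ cS B W ≫ l B) (𝟙 D) := by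
    intro B D
    have h := h1 (cT D B)
    rw [dR_eq]
    simp only [Category.assoc, cS_cS_a]
    rw [← h, Category.assoc, reassoc_of% (hd D B)]
    simp [cT_nat, cT_nat_a]
  @Pt.mk O (opLD L) W (fun A => cS A W ≫ l A) (fun g => h1 g) (fun A B => h2 A B)
    (fun B D => (Category.assoc _ _ _).trans (h3 B D))

theorem rho_Kc {C C' D D' : O} (p : Cpt (T C' C)) (q : Cpt (T D' D)) (A : O) :
    cS _ A ≫ rho (Kc p q) A = sm (tm (𝟙 _) (cT C D) ≫ aT (S C' D') D C ≫
      tm (ddR C' D' D ≫ rho q C') (𝟙 C)) (𝟙 A) ≫ cS (T C' C) A ≫ rho p A := by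
  have : rho (Kc p q) A = sm (𝟙 A) ((tm (𝟙 _) (cT C D) ≫ aT (S C' D') D C) ≫
      tm (ddR C' D' D ≫ rho q C') (𝟙 C)) ≫ rho p A := rfl
  rw [this, Category.assoc, cS_nat_a]

theorem rho_Kcd {C C' D D' : O} (p : Cpt (T C' C)) (q : Cpt (T D' D)) (A : O) :
    cS _ A ≫ rho (Kcd p q) A = sm (tm (cT C' D') (𝟙 _) ≫ aT' D' C' (S C D) ≫
      tm (𝟙 D') (d C' C D ≫ cS (T C' C) D ≫ rho p D)) (𝟙 A) ≫ cS (T D' D) A ≫ rho q A := by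
  have : rho (Kcd p q) A = sm (𝟙 A) ((tm (cT C' D') (𝟙 _) ≫ aT' D' C' (S C D)) ≫
      tm (𝟙 D') ((d C' C D ≫ cS (T C' C) D) ≫ rho p D)) ≫ rho q A := rfl
  rw [this, cS_nat_a]
  simp only [Category.assoc]

end gen

section real
variable {P : Type}

theorem qtm {A B D E : Form P} (f : Term P A D) (g : Term P B E) :
    q (f ⊼ g) = tm (q f) (q g) := rfl
theorem qsm {A B D E : Form P} (f : Term P A D) (g : Term P B E) :
    q (f ⊽ g) = sm (q f) (q g) := rfl
theorem qaT (A B C : Form P) : q (Term.bConjTo A B C) = aT A B C := rfl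
theorem qaT' (A B C : Form P) : q (Term.bConjFrom A B C) = aT' A B C := rfl
theorem qaS (A B C : Form P) : q (Term.bDisjTo A B C) = aS A B C := rfl
theorem qaS' (A B C : Form P) : q (Term.bDisjFrom A B C) = aS' A B C := rfl
theorem qcT (A B : Form P) : q (Term.cConj A B) = cT A B := rfl
theorem qcS (A B : Form P) : q (Term.cDisj A B) = cS B A := rfl
theorem qd (A B C : Form P) : q (Term.d A B C) = d A B C := rfl
theorem qddR (A B C : Form P) : q (dR A B C) = ddR A B C := rfl
theorem qid (A : Form P) : q (Term.id A) = 𝟙 A := rfl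
theorem qcomp' {A B C : Form P} (f : Term P A B) (g : Term P B C) : q (g ⬝ f) = q f ≫ q g := rfl

def dpt (B : Form P) : Pt (S (∼B) B) where
  z A := q (Term.delta B A)
  nat := by rintro A D ⟨f⟩; exact (q_eq.mpr (Eqv.deltaNat B f)).symm
  b A C := q_eq.mpr (Eqv.bDelta A C B)
  dl C D := (Category.assoc _ _ _).symm.trans (q_eq.mpr (Eqv.dSigmaConj B C D))

theorem q_dDeltaDisj (B C A : Form P) : d C A (T B (∼B)) ≫ cS (T C A) (T B (∼B)) ≫
    q (Term.sigma B (T C A)) = tm (𝟙 C) (cS A (T B (∼B)) ≫ q (Term.sigma B A)) := by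
  have h := q_eq.mpr (Eqv.dDeltaDisj B C A)
  simp only [deltaDisj, qcomp', Category.assoc, qtm, qid, qd, qcS] at h
  exact h

def scp (B : Form P) : Cpt (T B (∼B)) :=
  mkCpt (W := T B (∼B)) (fun A => q (Term.sigma B A))
    (by rintro A D ⟨f⟩; exact q_eq.mpr (Eqv.sigmaNat B f))
    (fun C A => q_eq.mpr (Eqv.bSigma B C A))
    (q_dDeltaDisj B)

theorem rho_scp (B A : Form P) : rho (scp B) A = cS A (T B (∼B)) ≫ q (Term.sigma B A) := rfl

theorem cS_scp (B A : Form P) : cS _ A ≫ rho (scp B) A = q (Term.sigma B A) := by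
  rw [rho_scp, cS_cS_a]

theorem cS_cfl_scp (B A : Form P) : cS _ A ≫ rho (cfl (scp B)) A = q (sigma' B A) := by
  unfold cfl
  rw [rho_cmap, ← cS_nat_a, rho_scp, cS_cS_a]
  rfl

theorem rho_cfl_scp (B A : Form P) : rho (cfl (scp B)) A = q (deltaDisj' B A) := by
  have h : q (deltaDisj' B A) = cS A (T (∼B) B) ≫ q (sigma' B A) := rfl
  rw [h, ← cS_cfl_scp, cS_cS_a]

theorem fl_dpt (B A : Form P) : (fl (dpt B)).z A = q (delta' B A) := rfl

def real (B : Form P) : DP B (∼B) where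
  η := fl (dpt B)
  ε := cfl (scp B)
  t1 := by
    rw [tri1_iff, fl_fl, cfl_cfl]
    unfold Tri2
    rw [cS_scp]
    exact (Category.assoc _ _ _).symm.trans (q_eq.mpr (Eqv.sigmaDelta B))
  t2 := by
    unfold Tri2
    rw [cS_cfl_scp]
    exact (Category.assoc _ _ _).symm.trans (q_eq.mpr (Eqv.sigmaDelta' B))

theorem q_nTo (A : Form P) : q (nTo A) = (real (∼A)).to (real A).flip := by
  unfold DP.to cmpr DP.flip real
  simp only [fl_fl]
  rw [cS_cfl_scp]
  simp only [nTo, qcomp', Category.assoc]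
  rfl

theorem q_nFrom (A : Form P) : q (nFrom A) = (real A).flip.to (real (∼A)) := by
  unfold DP.to cmpr DP.flip real
  simp only [cfl_cfl]
  rw [cS_scp]
  simp only [nFrom, qcomp', Category.assoc]
  rfl

theorem q_rConjTo (A B : Form P) :
    q (rConjTo A B) = (real (A ⋏ B)).to ((real A).conj (real B)) := by
  unfold DP.to cmpr DP.conj real K kmap
  rw [cS_cfl_scp, Pt.map_z]
  simp only [rConjTo, qcomp', Category.assoc, qtm, qsm, qaS', qcS, qd, qid]
  rfl

theorem q_rConjFrom (A B : Form P) :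
    q (rConjFrom A B) = ((real A).conj (real B)).to (real (A ⋏ B)) := by
  unfold DP.to cmpr DP.conj real
  simp only
  rw [rho_Kc, cS_cfl_scp, rho_cfl_scp]
  simp only [rConjFrom, qcomp', Category.assoc, qtm, qsm, qaT, qcT, qd, qid, qddR]
  rfl

theorem q_rDisjTo (A B : Form P) :
    q (rDisjTo A B) = (real (A ⋎ B)).to ((real A).disj (real B)) := by
  unfold DP.to cmpr DP.disj real Kd
  rw [cS_cfl_scp, Pt.map_z]
  simp only [rDisjTo, sigmaConj', qcomp', Category.assoc, qtm, qsm, qaS, qcS, qd, qid, qddR, qcT]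
  rfl

theorem q_rDisjFrom (A B : Form P) :
    q (rDisjFrom A B) = ((real A).disj (real B)).to (real (A ⋎ B)) := by
  unfold DP.to cmpr DP.disj real
  simp only
  rw [rho_Kcd, cS_cfl_scp, cS_cfl_scp]
  simp only [rDisjFrom, qcomp', Category.assoc, qtm, qsm, qaT', qcT, qd, qid, qddR]
  rfl

end real
end PNProof

namespace PNProof

open CategoryTheory LD

section gen
variable {O : Type} [L : LD O]

theorem iso_tm {A A' B B' : O} {f : A ⟶ B} {f' : B ⟶ A} {g : A' ⟶ B'} {g' : B' ⟶ A'}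
    (h : f ≫ f' = 𝟙 A) (k : g ≫ g' = 𝟙 A') : tm f g ≫ tm f' g' = 𝟙 _ := by
  rw [tm_comp, h, k, tm_id]

theorem iso_sm {A A' B B' : O} {f : A ⟶ B} {f' : B ⟶ A} {g : A' ⟶ B'} {g' : B' ⟶ A'}
    (h : f ≫ f' = 𝟙 A) (k : g ≫ g' = 𝟙 A') : sm f g ≫ sm f' g' = 𝟙 _ := by
  rw [sm_comp, h, k, sm_id]

theorem sq_tm {A A' B B' X Y X' Y' : O} {f : A ⟶ B} {g : A' ⟶ B'} {i : B ⟶ Y} {i' : B' ⟶ Y'}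
    {j : A ⟶ X} {j' : A' ⟶ X'} {k : X ⟶ Y} {k' : X' ⟶ Y'} (h : f ≫ i = j ≫ k)
    (h' : g ≫ i' = j' ≫ k') : tm f g ≫ tm i i' = tm j j' ≫ tm k k' := by
  rw [tm_comp, tm_comp, h, h']

theorem sq_sm {A A' B B' X Y X' Y' : O} {f : A ⟶ B} {g : A' ⟶ B'} {i : B ⟶ Y} {i' : B' ⟶ Y'}
    {j : A ⟶ X} {j' : A' ⟶ X'} {k : X ⟶ Y} {k' : X' ⟶ Y'} (h : f ≫ i = j ≫ k)
    (h' : g ≫ i' = j' ≫ k') : sm f g ≫ sm i i' = sm j j' ≫ sm k k' := by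
  rw [sm_comp, sm_comp, h, h']

theorem iso_comp {A B D : O} {f : A ⟶ B} {f' : B ⟶ A} {g : B ⟶ D} {g' : D ⟶ B}
    (h : f ≫ f' = 𝟙 A) (k : g ≫ g' = 𝟙 B) : (f ≫ g) ≫ (g' ≫ f') = 𝟙 _ := by
  rw [Category.assoc, reassoc_of% k, h]

theorem Compat.refl {X Y : O} (a : DP X Y) : Compat a a (𝟙 X) (𝟙 Y) where
  η := by apply Pt.ext'; intro A; simp
  ε := by apply rho_ext; intro A; rw [rho_cmap, tm_id, sm_id, Category.id_comp]

theorem K_z {C C' D D' : O} (p : Pt (S C C')) (q : Pt (S D D')) (A : O) :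
    ((K p q).map (sm (cT C D) (cS C' D'))).z A = p.z A ≫ tm (𝟙 A) (sm (q.z C ≫ d C D D') (𝟙 C') ≫
      aS' (T C D) D' C' ≫ sm (cT C D) (𝟙 _)) := by
  unfold K kmap
  simp

theorem Kd_z {C C' D D' : O} (p : Pt (S C C')) (q : Pt (S D D')) (A : O) :
    (Kd p q).z A = q.z A ≫ tm (𝟙 A) (sm (𝟙 D) (p.z D' ≫ cT D' (S C C') ≫ ddR C C' D') ≫
      aS D C (T C' D') ≫ sm (cS D C) (𝟙 _)) := rfl

theorem rho_Kc' {C C' D D' : O} (p : Cpt (T C' C)) (q : Cpt (T D' D)) (A : O) :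
    cS _ A ≫ rho (cmap (Kc p q) (tm (cS D' C') (cT D C))) A =
      sm (tm (cS D' C') (𝟙 _) ≫ aT (S C' D') D C ≫
      tm (ddR C' D' D ≫ rho q C') (𝟙 C)) (𝟙 A) ≫ cS (T C' C) A ≫ rho p A := by
  rw [rho_cmap, ← cS_nat_a, rho_Kc, sm_comp_a, tm_comp_a]
  simp

theorem nat_delta {X Y X' Y' A A' : O} {a : DP X Y} {b : DP X' Y'} {f : X ⟶ X'} {g : Y ⟶ Y'}
    (h : Compat a b f g) (k : A ⟶ A') :
    (fl a.η).z A ≫ tm k (sm g f) = k ≫ (fl b.η).z A' := by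
  have h := h.flip.η
  simp only [DP.flip] at h
  rw [← h, Pt.map_z, ← Category.assoc, Pt.nat, Category.assoc, tm_comp]
  simp

theorem nat_sigma {X Y X' Y' A A' : O} {a : DP X Y} {b : DP X' Y'} {f : X ⟶ X'} {g : Y ⟶ Y'}
    (h : Compat a b f g) (k : A ⟶ A') :
    (cS _ _ ≫ rho (cfl a.ε) A) ≫ k = sm (tm f g) k ≫ cS _ _ ≫ rho (cfl b.ε) A' := by
  have h := h.flip.ε
  simp only [DP.flip] at h
  rw [← h, rho_cmap]
  simp only [Category.assoc]
  rw [← rho_nat, sm_comp_a, ← cS_nat_a]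
  simp

end gen

section fin
variable {P : Type}

theorem iso_both (A : Form P) :
    (q (iPos A) ≫ q (iPosInv A) = 𝟙 _ ∧ q (iPosInv A) ≫ q (iPos A) = 𝟙 _) ∧
    (q (iNeg A) ≫ q (iNegInv A) = 𝟙 _ ∧ q (iNegInv A) ≫ q (iNeg A) = 𝟙 _) := by
  induction A with
  | letter p =>
    simp only [iPos, iPosInv, iNeg, iNegInv]
    exact ⟨⟨Category.id_comp _, Category.id_comp _⟩, ⟨Category.id_comp _, Category.id_comp _⟩⟩
  | neg A h =>
    obtain ⟨⟨h1, h2⟩, h3⟩ := h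
    have t1 := DP.to_to (real (∼A)) (real A).flip
    have t2 := DP.to_to (real A).flip (real (∼A))
    rw [← q_nTo, ← q_nFrom] at t1 t2
    simp only [iPos, iPosInv, iNeg, iNegInv]
    exact ⟨h3, iso_comp t1 h1, iso_comp h2 t2⟩
  | conj A B h k =>
    obtain ⟨⟨h1, h2⟩, h3, h4⟩ := h
    obtain ⟨⟨k1, k2⟩, k3, k4⟩ := k
    have t1 := DP.to_to (real (A ⋏ B)) ((real A).conj (real B))
    have t2 := DP.to_to ((real A).conj (real B)) (real (A ⋏ B))
    rw [← q_rConjTo, ← q_rConjFrom] at t1 t2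
    simp only [iPos, iPosInv, iNeg, iNegInv]
    exact ⟨⟨iso_tm h1 k1, iso_tm h2 k2⟩, iso_comp t1 (iso_sm h3 k3), iso_comp (iso_sm h4 k4) t2⟩
  | disj A B h k =>
    obtain ⟨⟨h1, h2⟩, h3, h4⟩ := h
    obtain ⟨⟨k1, k2⟩, k3, k4⟩ := k
    have t1 := DP.to_to (real (A ⋎ B)) ((real A).disj (real B))
    have t2 := DP.to_to ((real A).disj (real B)) (real (A ⋎ B))
    rw [← q_rDisjTo, ← q_rDisjFrom] at t1 t2
    simp only [iPos, iPosInv, iNeg, iNegInv]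
    exact ⟨⟨iso_sm h1 k1, iso_sm h2 k2⟩, iso_comp t1 (iso_tm h3 k3), iso_comp (iso_tm h4 k4) t2⟩

def e : (B : Form P) → DP (emb (Fpos B)) (emb (Fneg B))
  | .letter p => real (.letter p)
  | .neg B => (e B).flip
  | .conj A B => (e A).conj (e B)
  | .disj A B => (e A).disj (e B)

theorem compat_e (B : Form P) : Compat (real B) (e B) (q (iPos B)) (q (iNeg B)) := by
  induction B with
  | letter p =>
    simp only [iPos, iNeg, e]
    exact Compat.refl _
  | neg A h =>
    have := (Compat.to (real (∼A)) (real A).flip).comp h.flip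
    rw [Category.id_comp, ← q_nTo] at this
    simp only [iPos, iNeg, e]
    exact this
  | conj A B h k =>
    have := (Compat.to (real (A ⋏ B)) ((real A).conj (real B))).comp (h.conj k)
    rw [Category.id_comp, ← q_rConjTo] at this
    simp only [iPos, iNeg, e]
    exact this
  | disj A B h k =>
    have := (Compat.to (real (A ⋎ B)) ((real A).disj (real B))).comp (h.disj k)
    rw [Category.id_comp, ← q_rDisjTo] at this
    simp only [iPos, iNeg, e]
    exact this

theorem t_conj {C C' D D' A : Form P} {t : Term P D' (D' ⋏ (C ⋎ C'))}
    {u : Term P A (A ⋏ (D ⋎ D'))} {a : Pt (S C C')} {b : Pt (S D D')}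
    (ht : q t = a.z D') (hu : q u = b.z A) :
    q ((Term.id A ⊼ ((Term.cDisj C D ⊽ Term.id (C' ⋏ D')) ⬝ (Term.bDisjTo D C (C' ⋏ D') ⬝
      (Term.id D ⊽ (dR C C' D' ⬝ (Term.cConj D' (C ⋎ C') ⬝ t)))))) ⬝ u) = (Kd a b).z A := by
  rw [Kd_z, ← ht, ← hu]
  simp only [qcomp', qtm, qsm, Category.assoc]
  rfl

theorem t_disj {C C' D D' A : Form P} {t : Term P D (D ⋏ (C ⋎ C'))}
    {u : Term P A (A ⋏ (D ⋎ D'))} {a : Pt (S C C')} {b : Pt (S D D')}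
    (ht : q t = a.z D) (hu : q u = b.z A) :
    q ((Term.id A ⊼ ((Term.cConj D C ⊽ Term.id (C' ⋎ D')) ⬝ (Term.bDisjFrom (D ⋏ C) C' D' ⬝
      ((Term.d D C C' ⬝ t) ⊽ Term.id D')))) ⬝ u) = (K a b).z A := by
  rw [K_swap, K_z, ← ht, ← hu]
  simp only [qcomp', qtm, qsm, Category.assoc]
  rfl

theorem t_neg {C C' A : Form P} {t : Term P A (A ⋏ (C ⋎ C'))} {a : Pt (S C C')}
    (ht : q t = a.z A) : q ((Term.id A ⊼ Term.cDisj C' C) ⬝ t) = (fl a).z A := by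
  rw [qcomp', ht]
  rfl

theorem s_neg {C C' A : Form P} {t : Term P ((C ⋏ C') ⋎ A) A} {a : Cpt (T C C')}
    (ht : q t = cS _ _ ≫ rho a A) :
    q (t ⬝ (Term.cConj C' C ⊽ Term.id A)) = cS _ _ ≫ rho (cfl a) A := by
  rw [qcomp', ht, cfl, rho_cmap, ← cS_nat_a]
  rfl

theorem s_conj {C C' D D' A : Form P} {t : Term P ((C ⋏ C') ⋎ D') D'}
    {u : Term P ((D ⋏ D') ⋎ A) A} {a : Cpt (T C C')} {b : Cpt (T D D')}
    (ht : q t = cS _ _ ≫ rho a D') (hu : q u = cS _ _ ≫ rho b A) :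
    q (u ⬝ (((Term.id D ⊼ (t ⬝ Term.d C C' D')) ⬝ (Term.bConjFrom D C (C' ⋎ D') ⬝
      (Term.cConj C D ⊼ Term.id (C' ⋎ D')))) ⊽ Term.id A)) = cS _ _ ≫ rho (Kcd a b) A := by
  rw [rho_Kcd, ← ht, ← hu]
  simp only [qcomp', qtm, qsm, Category.assoc]
  rfl

theorem s_disj {C C' D D' A : Form P} {t : Term P ((C ⋏ C') ⋎ D) D}
    {u : Term P ((D ⋏ D') ⋎ A) A} {a : Cpt (T C C')} {b : Cpt (T D D')}
    (ht : q t = cS _ _ ≫ rho a D) (hu : q u = cS _ _ ≫ rho b A) :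
    q (u ⬝ ((((t ⬝ (Term.cDisj (C ⋏ C') D ⬝ dR D C C')) ⊼ Term.id D') ⬝
      (Term.bConjTo (D ⋎ C) C' D' ⬝ (Term.cDisj D C ⊼ Term.id (C' ⋏ D')))) ⊽ Term.id A)) =
      cS _ _ ≫ rho (Kc a b) A := by
  have h : rho a D = cS _ _ ≫ q t := by
    rw [ht]; exact (cS_cS_a _).symm
  rw [Kc_swap, rho_Kc', ← hu, h]
  simp only [qcomp', qtm, qsm, Category.assoc]
  rfl

theorem e_delta (B : Form P) : ∀ A, q (embT (Fdelta B A)) = (fl (e B).η).z (emb (Fpos A)) := by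
  induction B with
  | letter p =>
    intro A
    exact (congrArg (fun r => Pt.z r (emb (Fpos A))) (fl_fl (dpt (.letter p)))).symm
  | neg B h =>
    intro A
    exact t_neg (h A)
  | conj B D hB hD =>
    intro A
    have h : fl (e (B ⋏ D)).η = Kd (fl (e B).η) (fl (e D).η) := by
      rw [Kd_eq, fl_fl, fl_fl]; rfl
    rw [h]
    exact t_conj (hB D) (hD A)
  | disj B D hB hD =>
    intro A
    have h : fl (e (B ⋎ D)).η = K (fl (e B).η) (fl (e D).η) := by
      have h := fl_fl (K (fl (e B).η) (fl (e D).η))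
      rw [← Kd_eq] at h
      exact h
    rw [h]
    exact t_disj (hB (∼D)) (hD A)

theorem e_sigma (B : Form P) : ∀ A, q (embT (Fsigma B A)) =
    cS _ _ ≫ rho (cfl (e B).ε) (emb (Fpos A)) := by
  induction B with
  | letter p =>
    intro A
    have h := cS_scp (.letter p) (emb (Fpos A))
    rw [← cfl_cfl (scp (.letter p))] at h
    exact h.symm
  | neg B h =>
    intro A
    exact s_neg (h A)
  | conj B D hB hD =>
    intro A
    have h : cfl (e (B ⋏ D)).ε = Kcd (cfl (e B).ε) (cfl (e D).ε) := by
      rw [Kcd_eq, cfl_cfl, cfl_cfl]; rfl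
    rw [h]
    exact s_conj (hB (∼D)) (hD A)
  | disj B D hB hD =>
    intro A
    have h : cfl (e (B ⋎ D)).ε = Kc (cfl (e B).ε) (cfl (e D).ε) := by
      have h := cfl_cfl (Kc (cfl (e B).ε) (cfl (e D).ε))
      rw [← Kcd_eq] at h
      exact h
    rw [h]
    exact s_disj (hB D) (hD A)

theorem nat_i {A B : Form P} (f : Term P A B) :
    q f ≫ q (iPos B) = q (iPos A) ≫ q (embT (Ft f)) := by
  induction f with
  | id A => simp only [Ft, embT, qid, Category.id_comp]; exact (Category.comp_id _).symm
  | comp g f hg hf => 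
    simp only [Ft, embT, qcomp', Category.assoc]
    rw [hg, reassoc_of% hf]
  | conj f g hf hg =>
    simp only [iPos]
    exact sq_tm hf hg
  | disj f g hf hg =>
    simp only [iPos]
    exact sq_sm hf hg
  | bConjTo A B C =>
    simp only [iPos]
    exact (aT_nat (q (iPos A)) (q (iPos B)) (q (iPos C))).symm
  | bConjFrom A B C =>
    simp only [iPos]
    exact (aT'_nat (q (iPos A)) (q (iPos B)) (q (iPos C))).symm
  | bDisjTo A B C =>
    simp only [iPos]
    exact (aS_nat (q (iPos A)) (q (iPos B)) (q (iPos C))).symm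
  | bDisjFrom A B C =>
    simp only [iPos]
    exact (aS'_nat (q (iPos A)) (q (iPos B)) (q (iPos C))).symm
  | d A B C =>
    simp only [iPos]
    exact (d_nat (q (iPos A)) (q (iPos B)) (q (iPos C))).symm
  | cConj A B =>
    simp only [iPos]
    exact (cT_nat (q (iPos A)) (q (iPos B))).symm
  | cDisj A B =>
    simp only [iPos]
    exact (cS_nat (q (iPos B)) (q (iPos A))).symm
  | delta B A =>
    have h3 : q (Term.delta B A) = (fl (real B).η).z A := by
      simp only [real, fl_fl]; rfl
    have h := nat_delta (compat_e B) (q (iPos A))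
    rw [← e_delta, ← h3] at h
    simp only [iPos]
    exact h
  | sigma B A =>
    have h3 : q (Term.sigma B A) = cS _ _ ≫ rho (cfl (real B).ε) A := by
      simp only [real, cfl_cfl]; exact (cS_scp _ _).symm
    have h := nat_sigma (compat_e B) (q (iPos A))
    rw [← e_sigma, ← h3] at h
    simp only [iPos]
    exact h

theorem F_emb (X : PForm P) : Fpos (emb X) = X := by
  induction X with
  | pos p => rfl
  | natom p => rfl
  | conj A B hA hB => exact congrArg₂ PForm.conj hA hB
  | disj A B hA hB => exact congrArg₂ PForm.disj hA hB

theorem heq_id {A A' : PForm P} (h : A = A') : HEq (PTerm.id A) (PTerm.id A') := by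
  subst h; rfl

theorem heq_comp {A A' B B' C C' : PForm P} (hA : A = A') (hB : B = B') (hC : C = C')
    {g : PTerm P B C} {g' : PTerm P B' C'} {f : PTerm P A B} {f' : PTerm P A' B'}
    (hg : HEq g g') (hf : HEq f f') : HEq (g ⊚ f) (g' ⊚ f') := by
  subst hA hB hC hg hf; rfl

theorem heq_conj {A A' B B' C C' D D' : PForm P} (hA : A = A') (hB : B = B') (hC : C = C')
    (hD : D = D') {g : PTerm P A B} {g' : PTerm P A' B'} {f : PTerm P C D} {f' : PTerm P C' D'}
    (hg : HEq g g') (hf : HEq f f') : HEq (g ⊛ f) (g' ⊛ f') := by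
  subst hA hB hC hD hg hf; rfl

theorem heq_disj {A A' B B' C C' D D' : PForm P} (hA : A = A') (hB : B = B') (hC : C = C')
    (hD : D = D') {g : PTerm P A B} {g' : PTerm P A' B'} {f : PTerm P C D} {f' : PTerm P C' D'}
    (hg : HEq g g') (hf : HEq f f') : HEq (g ⊘ f) (g' ⊘ f') := by
  subst hA hB hC hD hg hf; rfl

theorem heq_of₁ {s t : PForm P → PForm P} (c : ∀ A, PTerm P (s A) (t A)) {A A' : PForm P}
    (hA : A = A') : HEq (c A) (c A') := by
  subst hA; rfl

theorem heq_of₂ {s t : PForm P → PForm P → PForm P} (c : ∀ A B, PTerm P (s A B) (t A B))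
    {A A' B B' : PForm P} (hA : A = A') (hB : B = B') : HEq (c A B) (c A' B') := by
  subst hA hB; rfl

theorem heq_of₃ {s t : PForm P → PForm P → PForm P → PForm P}
    (c : ∀ A B C, PTerm P (s A B C) (t A B C)) {A A' B B' C C' : PForm P}
    (hA : A = A') (hB : B = B') (hC : C = C') : HEq (c A B C) (c A' B' C') := by
  subst hA hB hC; rfl

theorem F_embT {X Y : PForm P} (g : PTerm P X Y) : HEq (Ft (embT g)) g := by
  induction g with
  | id A => exact heq_id (F_emb A)
  | comp g f hg hf => exact heq_comp (F_emb _) (F_emb _) (F_emb _) hg hf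
  | conj f g hf hg => exact heq_conj (F_emb _) (F_emb _) (F_emb _) (F_emb _) hf hg
  | disj f g hf hg => exact heq_disj (F_emb _) (F_emb _) (F_emb _) (F_emb _) hf hg
  | bConjTo A B C => exact heq_of₃ PTerm.bConjTo (F_emb A) (F_emb B) (F_emb C)
  | bConjFrom A B C => exact heq_of₃ PTerm.bConjFrom (F_emb A) (F_emb B) (F_emb C)
  | bDisjTo A B C => exact heq_of₃ PTerm.bDisjTo (F_emb A) (F_emb B) (F_emb C)
  | bDisjFrom A B C => exact heq_of₃ PTerm.bDisjFrom (F_emb A) (F_emb B) (F_emb C)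
  | d A B C => exact heq_of₃ PTerm.d (F_emb A) (F_emb B) (F_emb C)
  | cConj A B => exact heq_of₂ PTerm.cConj (F_emb A) (F_emb B)
  | cDisj A B => exact heq_of₂ (fun A B => PTerm.cDisj A B) (F_emb A) (F_emb B)
  | delta p A => exact heq_of₁ (PTerm.delta p) (F_emb A)
  | sigma p A => exact heq_of₁ (PTerm.sigma p) (F_emb A)

theorem main (P : Type) :
    (∀ (A B : Form P) (f : Term P A B),
      Eqv f (iPosInv B ⬝ (embT (Ft f) ⬝ iPos A))) ∧
    (∀ A : Form P,
      Eqv (iPosInv A ⬝ iPos A) (Term.id A) ∧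
      Eqv (iPos A ⬝ iPosInv A) (Term.id (emb (Fpos A)))) ∧
    (∀ (A B : Form P) (f : Term P A B),
      Eqv (iPos B ⬝ f) (embT (Ft f) ⬝ iPos A)) ∧
    (∀ (X Y : PForm P) (g : PTerm P X Y), HEq (Ft (embT g)) g) := by
  refine ⟨fun A B f => ?_, fun A => ⟨?_, ?_⟩, fun A B f => ?_, fun X Y g => F_embT g⟩
  · rw [← q_eq, qcomp', qcomp', ← nat_i, Category.assoc, (iso_both B).1.1, Category.comp_id]
  · exact q_eq.mp (iso_both A).1.1
  · exact q_eq.mp (iso_both A).1.2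
  · exact q_eq.mp (nat_i f)

end fin
end PNProof

/-- **Auxiliary Lemma and the equivalence of PN¬ and PN**: for every arrow term
`f : A ⊢ B` of PN¬ one has `f = i_B⁻¹ ∘ Ff ∘ i_A` in PN¬, where `F` is the
functor from PN¬ to PN (composed with the inclusion `F¬` of PN into PN¬) and
`i_A : A ⊢ FA` is the inductively defined isomorphism of PN¬.  Consequently `i`
is a natural isomorphism from the identity functor on PN¬ to `F¬F` (each `i_A`
is invertible in PN¬ and `i` is natural), and together with `F F¬ = Id` (on
objects and arrow terms) this makes the categories PN¬ and PN equivalent via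
the functors `F : PN¬ → PN` and `F¬ : PN → PN¬`. -/
theorem auxiliary_lemma_and_equivalence {P : Type} :
    (∀ (A B : Form P) (f : Term P A B),
      Eqv f (iPosInv B ⬝ (embT (Ft f) ⬝ iPos A))) ∧
    (∀ A : Form P,
      Eqv (iPosInv A ⬝ iPos A) (Term.id A) ∧
      Eqv (iPos A ⬝ iPosInv A) (Term.id (emb (Fpos A)))) ∧
    (∀ (A B : Form P) (f : Term P A B),
      Eqv (iPos B ⬝ f) (embT (Ft f) ⬝ iPos A)) ∧
    (∀ (X Y : PForm P) (g : PTerm P X Y), HEq (Ft (embT g)) g) := by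
  exact PNProof.main P
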